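/- For every p with 1<p<∞ there exists a constant C>0 such that for every u∈C_c^∞(ℝ³,ℂ⁴) one has ‖∇u‖_{L^p(ℝ³)} ≤ C·‖(−i α·∇)u‖_{L^p(ℝ³)}, where ‖∇u‖_{L^p(ℝ³)} = (∫_{ℝ³} (Σ_{j=1}³ |∂_{x_j}u(x)|²_{ℂ⁴})^{p/2} dx)^{1/p} and ‖(−i α·∇)u‖_{L^p(ℝ³)} = (∫_{ℝ³} |−i Σ_{j=1}³ α_j ∂_{x_j}u(x)|^p_{ℂ⁴} dx)^{1/p}. -/

import Mathlib

open MeasureTheory Complex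

noncomputable section

/-- `ℝ³`. -/
abbrev R3 := EuclideanSpace ℝ (Fin 3)
/-- `ℂ⁴`. -/
abbrev C4 := EuclideanSpace ℂ (Fin 4)

/-- The 4×4 Pauli–Dirac matrices `α₁, α₂, α₃` (with blocks `((0,σⱼ),(σⱼ,0))`). -/
def pauliDirac : Fin 3 → Matrix (Fin 4) (Fin 4) ℂ
  | 0 => !![0, 0, 0, 1; 0, 0, 1, 0; 0, 1, 0, 0; 1, 0, 0, 0]
  | 1 => !![0, 0, 0, -Complex.I; 0, 0, Complex.I, 0; 0, -Complex.I, 0, 0; Complex.I, 0, 0, 0]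
  | 2 => !![0, 0, 1, 0; 0, 0, 0, -1; 1, 0, 0, 0; 0, -1, 0, 0]

/-- The 4×4 matrix `β = ((I₂,0),(0,−I₂))`. -/
def diracBeta : Matrix (Fin 4) (Fin 4) ℂ := !![1, 0, 0, 0; 0, 1, 0, 0; 0, 0, -1, 0; 0, 0, 0, -1]

/-- Action of a 4×4 complex matrix on `ℂ⁴`. -/
def mulC4 (A : Matrix (Fin 4) (Fin 4) ℂ) (v : C4) : C4 :=
  (WithLp.equiv 2 (Fin 4 → ℂ)).symm (A.mulVec ((WithLp.equiv 2 (Fin 4 → ℂ)) v))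

/-- The partial derivative `∂_{x_j} u (x)` of `u : ℝ³ → ℂ⁴`. -/
def pderiv3 (u : R3 → C4) (j : Fin 3) (x : R3) : C4 :=
  fderiv ℝ u x (EuclideanSpace.single j 1)

/-- `(α·∇u)(x) = Σ_{j=1}³ α_j ∂_{x_j} u (x)`. -/
def alphaGrad (u : R3 → C4) (x : R3) : C4 :=
  ∑ j : Fin 3, mulC4 (pauliDirac j) (pderiv3 u j x)


set_option linter.unusedSectionVars false
set_option linter.unusedSimpArgs false

section HeatFlow

variable {V : Type*} [NormedAddCommGroup V] [InnerProductSpace ℝ V] [FiniteDimensional ℝ V]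

/-- standard basis vector of `R3` -/
def eb (j : Fin 3) : R3 := EuclideanSpace.single j 1

/-- test functions -/
def Tst (f : R3 → V) : Prop := ContDiff ℝ (⊤ : ℕ∞) f ∧ HasCompactSupport f

/-- partial derivative -/
def dd (j : Fin 3) (f : R3 → V) (x : R3) : V := fderiv ℝ f x (eb j)

lemma Tst.dd {f : R3 → V} (hf : Tst f) (j : Fin 3) : Tst (dd j f) := by
  refine ⟨?_, ?_⟩
  · have h1 : ContDiff ℝ (⊤ : ℕ∞) (fderiv ℝ f) := hf.1.fderiv_right (by simp)
    exact h1.clm_apply contDiff_const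
  · exact hf.2.fderiv_apply ℝ (eb j)

lemma Tst.cont {f : R3 → V} (hf : Tst f) : Continuous f := hf.1.continuous

lemma Tst.integrable {f : R3 → V} (hf : Tst f) : Integrable f :=
  hf.cont.integrable_of_hasCompactSupport hf.2

lemma Tst.hasFDerivAt {f : R3 → V} (hf : Tst f) (x : R3) : HasFDerivAt f (fderiv ℝ f x) x :=
  (hf.1.differentiable (by simp) x).hasFDerivAt

lemma Tst.bdd {f : R3 → V} (hf : Tst f) : ∃ M, 0 ≤ M ∧ ∀ x, ‖f x‖ ≤ M := by
  obtain ⟨M, hM⟩ := hf.2.exists_bound_of_continuous hf.cont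
  exact ⟨M, (norm_nonneg _).trans (hM 0), hM⟩

lemma Tst.bdd4 {f : R3 → V} (hf : Tst f) :
    ∃ M, 0 ≤ M ∧ ∀ x, (1 + ‖x‖) ^ 4 * ‖f x‖ ≤ M := by
  have h1 : HasCompactSupport (fun x : R3 => ((1 + ‖x‖) ^ 4) • f x) := hf.2.smul_left
  obtain ⟨M, hM⟩ := h1.exists_bound_of_continuous (by have := hf.cont; fun_prop)
  refine ⟨M, (norm_nonneg _).trans (hM 0), fun x => ?_⟩
  have := hM x
  rwa [norm_smul, Real.norm_of_nonneg (by positivity)] at this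

lemma Tst.fderiv_bdd {f : R3 → V} (hf : Tst f) : ∃ M, 0 ≤ M ∧ ∀ x, ‖fderiv ℝ f x‖ ≤ M := by
  have h1 : HasCompactSupport (fderiv ℝ f) := hf.2.fderiv ℝ
  obtain ⟨M, hM⟩ := h1.exists_bound_of_continuous (hf.1.continuous_fderiv (by simp))
  exact ⟨M, (norm_nonneg _).trans (hM 0), hM⟩

/-- normalising constant -/
def gz : ℝ := ∫ z : R3, Real.exp (-‖z‖ ^ 2 / 2)

/-- Gaussian density -/
def gau (y : R3) : ℝ := gz⁻¹ * Real.exp (-‖y‖ ^ 2 / 2)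

lemma exp_bound (r : ℝ) : Real.exp (-r ^ 2 / 2) * (1 + r) ^ 8 ≤ 6144 * Real.exp (1 / 2) := by
  have h1 : ((1 + r ^ 2) / 2) ^ 4 / (Nat.factorial 4 : ℝ) ≤ Real.exp ((1 + r ^ 2) / 2) :=
    Real.pow_div_factorial_le_exp _ (by positivity) 4
  have h2 : (1 + r) ^ 8 ≤ 16 * (1 + r ^ 2) ^ 4 := by
    have : (1 + r) ^ 2 ≤ 2 * (1 + r ^ 2) := by nlinarith [sq_nonneg (1 - r)]
    calc (1 + r) ^ 8 = ((1 + r) ^ 2) ^ 4 := by ring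
      _ ≤ (2 * (1 + r ^ 2)) ^ 4 := by gcongr
      _ = _ := by ring
  have h3 : (Nat.factorial 4 : ℝ) = 24 := by norm_num [Nat.factorial]
  rw [h3] at h1
  have h4 : (1 + r) ^ 8 ≤ 6144 * Real.exp ((1 + r ^ 2) / 2) := by
    have : (1 + r ^ 2) ^ 4 = 16 * 24 * (((1 + r ^ 2) / 2) ^ 4 / 24) := by ring
    linarith
  calc Real.exp (-r ^ 2 / 2) * (1 + r) ^ 8
      ≤ Real.exp (-r ^ 2 / 2) * (6144 * Real.exp ((1 + r ^ 2) / 2)) := by gcongr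
    _ = 6144 * (Real.exp (-r ^ 2 / 2) * Real.exp ((1 + r ^ 2) / 2)) := by ring
    _ = 6144 * Real.exp (1 / 2) := by rw [← Real.exp_add]; congr 2; ring

lemma jap_int : Integrable (fun x : R3 => ((1 + ‖x‖) ^ 4)⁻¹) := by
  have := integrable_one_add_norm (E := R3) (μ := volume) (r := 4) (by simp; norm_num)
  refine this.congr (Filter.Eventually.of_forall fun x => ?_)
  simp only
  rw [Real.rpow_neg (by positivity)]
  norm_cast

lemma exp_int4 : Integrable (fun y : R3 => Real.exp (-‖y‖ ^ 2 / 2) * (1 + ‖y‖) ^ 4) := by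
  refine (jap_int.const_mul (6144 * Real.exp (1 / 2))).mono'
    (by apply Continuous.aestronglyMeasurable; fun_prop) (Filter.Eventually.of_forall fun y => ?_)
  rw [Real.norm_of_nonneg (by positivity), ← div_eq_mul_inv, le_div_iff₀ (by positivity)]
  have := exp_bound ‖y‖
  calc _ = Real.exp (-‖y‖ ^ 2 / 2) * (1 + ‖y‖) ^ 8 := by ring
    _ ≤ _ := this

lemma exp_int : Integrable (fun y : R3 => Real.exp (-‖y‖ ^ 2 / 2)) := by
  refine exp_int4.mono' (by apply Continuous.aestronglyMeasurable; fun_prop)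
    (Filter.Eventually.of_forall fun y => ?_)
  rw [Real.norm_of_nonneg (by positivity)]
  refine le_mul_of_one_le_right (by positivity) (one_le_pow₀ (by linarith [norm_nonneg y]))

lemma gz_pos : 0 < gz := integral_exp_pos exp_int

lemma gau_nonneg (y : R3) : 0 ≤ gau y := by
  have := gz_pos
  unfold gau; positivity

lemma gau_le (y : R3) : gau y ≤ gz⁻¹ := by
  have := gz_pos
  unfold gau
  refine mul_le_of_le_one_right (by positivity) (Real.exp_le_one_iff.2 ?_)
  nlinarith [sq_nonneg ‖y‖]

lemma gau_cont : Continuous gau := by unfold gau; fun_prop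

lemma gau_int4 : Integrable (fun y : R3 => gau y * (1 + ‖y‖) ^ 4) := by
  refine (exp_int4.const_mul gz⁻¹).congr (Filter.Eventually.of_forall fun x => ?_)
  simp only [gau]; ring

lemma gau_int : Integrable gau := exp_int.const_mul _

lemma gau_int1 : Integrable (fun y : R3 => gau y * ‖y‖) := by
  refine gau_int4.mono' (by apply Continuous.aestronglyMeasurable; have := gau_cont; fun_prop)
    (Filter.Eventually.of_forall fun y => ?_)
  have := gau_nonneg y
  rw [Real.norm_of_nonneg (by positivity)]
  gcongr
  have h : 0 ≤ ‖y‖ := norm_nonneg y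
  nlinarith [one_le_pow₀ (n := 3) (by linarith : 1 ≤ 1 + ‖y‖)]

lemma gau_integral : ∫ y, gau y = 1 := by
  unfold gau
  rw [integral_const_mul]
  exact inv_mul_cancel₀ gz_pos.ne'

lemma norm_eb (j : Fin 3) : ‖eb j‖ = 1 := by simp [eb]

lemma gau_deriv (j : Fin 3) (y : R3) : HasLineDerivAt ℝ gau (-(y j) * gau y) y (eb j) := by
  have h : HasFDerivAt (fun y : R3 => ‖y‖ ^ 2) (2 • innerSL ℝ y) y :=
    (hasStrictFDerivAt_norm_sq y).hasFDerivAt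
  have h2 := ((h.neg.mul_const (1 / 2 : ℝ)).exp.const_mul gz⁻¹).hasLineDerivAt (eb j)
  have e : (fun y : R3 => gz⁻¹ * Real.exp (-‖y‖ ^ 2 * (1 / 2))) = gau := by
    funext y; unfold gau; congr 2; ring
  have hi : inner ℝ y (eb j) = y j := by simp [eb, EuclideanSpace.inner_single_right]
  rw [show (fun y : R3 => gz⁻¹ * Real.exp ((-fun y : R3 => ‖y‖ ^ 2) y * (1 / 2))) = gau from e]
    at h2
  have e2 : (gz⁻¹ • Real.exp ((-fun y : R3 => ‖y‖ ^ 2) y * (1 / 2)) • (1 / 2 : ℝ) •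
      -(2 • (innerSL ℝ) y)) (eb j) = -y j * gau y := by
    have e3 : gau y = gz⁻¹ * Real.exp (-‖y‖ ^ 2 * (1 / 2)) := by rw [← e]
    rw [e3]
    simp [hi]
    ring
  rw [e2] at h2
  exact h2

/-- heat flow -/
def hfl (f : R3 → V) (s : ℝ) (x : R3) : V := ∫ y, gau y • f (x + s • y)

lemma hfl_zero (f : R3 → V) (x : R3) : hfl f 0 x = f x := by
  simp only [hfl, zero_smul, add_zero]
  rw [integral_smul_const, gau_integral, one_smul]

lemma hfl_integrand {f : R3 → V} (hf : Tst f) (s : ℝ) (x : R3) :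
    Integrable (fun y => gau y • f (x + s • y)) := by
  obtain ⟨M, hM0, hM⟩ := hf.bdd
  have := hf.cont; have := gau_cont
  refine (gau_int.mul_const M).mono' (by apply Continuous.aestronglyMeasurable; fun_prop)
    (Filter.Eventually.of_forall fun y => ?_)
  rw [norm_smul, Real.norm_of_nonneg (gau_nonneg y)]
  exact mul_le_mul_of_nonneg_left (hM _) (gau_nonneg y)

lemma hfl_cont {f : R3 → V} (hf : Tst f) : Continuous (fun z : ℝ × R3 => hfl f z.1 z.2) := by
  obtain ⟨M, hM0, hM⟩ := hf.bdd
  have := hf.cont; have := gau_cont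
  refine continuous_of_dominated (bound := fun y => gau y * M) (fun z => ?_) (fun z => ?_)
    (gau_int.mul_const M) ?_
  · apply Continuous.aestronglyMeasurable; fun_prop
  · refine (Filter.Eventually.of_forall fun y => ?_)
    rw [norm_smul, Real.norm_of_nonneg (gau_nonneg y)]
    exact mul_le_mul_of_nonneg_left (hM _) (gau_nonneg y)
  · refine (Filter.Eventually.of_forall fun y => ?_)
    fun_prop

lemma hfl_dx {f : R3 → V} (hf : Tst f) (j : Fin 3) (s : ℝ) (x : R3) :
    HasLineDerivAt ℝ (hfl f s) (hfl (dd j f) s x) x (eb j) := by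
  obtain ⟨M, hM0, hM⟩ := (hf.dd j).bdd
  have := hf.cont; have := gau_cont; have := (hf.dd j).cont
  unfold HasLineDerivAt hfl
  have := (hasDerivAt_integral_of_dominated_loc_of_deriv_le (μ := volume) (x₀ := (0 : ℝ))
    (s := Set.univ) (F := fun t y => gau y • f (x + t • eb j + s • y))
    (F' := fun t y => gau y • dd j f (x + t • eb j + s • y)) (bound := fun y => gau y * M)
    Filter.univ_mem ?_ ?_ ?_ ?_ (gau_int.mul_const M) ?_).2
  · simpa using this
  · refine (Filter.Eventually.of_forall fun y => ?_)
    apply Continuous.aestronglyMeasurable; fun_prop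
  · exact hfl_integrand hf _ _
  · apply Continuous.aestronglyMeasurable; fun_prop
  · refine (Filter.Eventually.of_forall fun y t _ => ?_)
    rw [norm_smul, Real.norm_of_nonneg (gau_nonneg y)]
    exact mul_le_mul_of_nonneg_left (hM _) (gau_nonneg y)
  · refine (Filter.Eventually.of_forall fun y t _ => ?_)
    have h1 : HasDerivAt (fun t : ℝ => x + t • eb j + s • y) (eb j) t := by
      simpa using (((hasDerivAt_id t).smul_const (eb j)).const_add x).add_const (s • y)
    exact ((hf.hasFDerivAt (x + t • eb j + s • y)).comp_hasDerivAt t h1).const_smul (gau y)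

lemma sum_eb (y : R3) : y = ∑ j, y j • eb j := by
  ext i
  fin_cases i <;> simp [eb, Fin.sum_univ_three]

lemma hfl_ds_aux {f : R3 → V} (hf : Tst f) (s : ℝ) (x : R3) (j : Fin 3) :
    ∫ y : R3, (y j * gau y) • dd j f (x + s • y) = s • hfl (dd j (dd j f)) s x := by
  obtain ⟨M, hM0, hM⟩ := (hf.dd j).bdd
  obtain ⟨M2, hM20, hM2⟩ := ((hf.dd j).dd j).bdd
  have := hf.cont; have := gau_cont; have := (hf.dd j).cont; have := ((hf.dd j).dd j).cont
  have key := integral_bilinear_hasLineDerivAt_right_eq_neg_left_of_integrable (μ := volume)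
    (f := gau) (f' := fun y => -(y j) * gau y) (g := fun y : R3 => dd j f (x + s • y))
    (g' := fun y : R3 => s • dd j (dd j f) (x + s • y)) (v := eb j)
    (B := ContinuousLinearMap.lsmul ℝ ℝ) ?_ ?_ ?_ (fun y _ => gau_deriv j y) ?_
  · simp only [ContinuousLinearMap.lsmul_apply, neg_mul, neg_smul, integral_neg, neg_neg] at key
    rw [← key, hfl, ← integral_smul]
    refine integral_congr_ae (Filter.Eventually.of_forall fun y => ?_)
    simp only [smul_smul, mul_comm]
  · simp only [ContinuousLinearMap.lsmul_apply]
    refine (gau_int1.mul_const M).mono' (by apply Continuous.aestronglyMeasurable; fun_prop)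
      (Filter.Eventually.of_forall fun y => ?_)
    rw [norm_smul, norm_mul, norm_neg, Real.norm_of_nonneg (gau_nonneg y), mul_comm ‖y j‖]
    have := gau_nonneg y
    have h3 : ‖y j‖ ≤ ‖y‖ := PiLp.norm_apply_le y j
    have := hM (x + s • y)
    gcongr
  · simp only [ContinuousLinearMap.lsmul_apply]
    refine ((hfl_integrand ((hf.dd j).dd j) s x).smul s).congr
      (Filter.Eventually.of_forall fun y => ?_)
    simp only [Pi.smul_apply, smul_smul, mul_comm]
  · exact hfl_integrand (hf.dd j) s x
  · intro y _
    have h1 : HasDerivAt (fun t : ℝ => x + s • (y + t • eb j)) (s • eb j) 0 := by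
      simpa using ((((hasDerivAt_id (0 : ℝ)).smul_const (eb j)).const_add y).const_smul s).const_add x
    have h2 := ((hf.dd j).hasFDerivAt (x + s • (y + (0 : ℝ) • eb j))).comp_hasDerivAt (0 : ℝ) h1
    simp only [zero_smul, add_zero, map_smul] at h2
    exact h2

lemma hfl_ds {f : R3 → V} (hf : Tst f) (s : ℝ) (x : R3) :
    HasDerivAt (fun s => hfl f s x) (s • ∑ j, hfl (dd j (dd j f)) s x) s := by
  obtain ⟨M, hM0, hM⟩ := hf.fderiv_bdd
  have := hf.cont; have := gau_cont; have := fun j => (hf.dd j).cont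
  have hc := hf.1.continuous_fderiv (by simp)
  unfold hfl
  have := (hasDerivAt_integral_of_dominated_loc_of_deriv_le (μ := volume) (x₀ := s)
    (s := Set.univ) (F := fun t y => gau y • f (x + t • y))
    (F' := fun t y => gau y • fderiv ℝ f (x + t • y) y) (bound := fun y => gau y * ‖y‖ * M)
    Filter.univ_mem ?_ ?_ ?_ ?_ (gau_int1.mul_const M) ?_).2
  · convert this using 1
    have e : ∀ y : R3, gau y • fderiv ℝ f (x + s • y) y =
        ∑ j, (y j * gau y) • dd j f (x + s • y) := by
      intro y
      conv_lhs => rw [sum_eb y]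
      rw [map_sum, Finset.smul_sum]
      rw [← sum_eb y]
      refine Finset.sum_congr rfl fun j _ => ?_
      rw [map_smul, smul_smul, mul_comm]; rfl
    simp_rw [e]
    rw [integral_finsetSum, Finset.smul_sum]
    · refine Finset.sum_congr rfl fun j _ => ?_
      exact (hfl_ds_aux hf s x j).symm
    · intro j _
      obtain ⟨M, hM0, hM⟩ := (hf.dd j).bdd
      refine (gau_int1.mul_const M).mono' (by apply Continuous.aestronglyMeasurable; fun_prop)
        (Filter.Eventually.of_forall fun y => ?_)
      rw [norm_smul, norm_mul, Real.norm_of_nonneg (gau_nonneg y), mul_comm ‖y j‖]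
      have := gau_nonneg y
      have h3 : ‖y j‖ ≤ ‖y‖ := PiLp.norm_apply_le y j
      have := hM (x + s • y)
      gcongr
  · refine (Filter.Eventually.of_forall fun y => ?_)
    apply Continuous.aestronglyMeasurable; fun_prop
  · exact hfl_integrand hf _ _
  · apply Continuous.aestronglyMeasurable; fun_prop
  · refine (Filter.Eventually.of_forall fun y t _ => ?_)
    rw [norm_smul, Real.norm_of_nonneg (gau_nonneg y), mul_assoc]
    refine mul_le_mul_of_nonneg_left ?_ (gau_nonneg y)
    refine (ContinuousLinearMap.le_opNorm _ _).trans ?_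
    rw [mul_comm]
    exact mul_le_mul_of_nonneg_left (hM _) (norm_nonneg y)
  · refine (Filter.Eventually.of_forall fun y t _ => ?_)
    have h1 : HasDerivAt (fun t : ℝ => x + t • y) y t := by
      simpa using ((hasDerivAt_id t).smul_const y).const_add x
    exact ((hf.hasFDerivAt (x + t • y)).comp_hasDerivAt t h1).const_smul (gau y)

lemma hfl_decay {f : R3 → V} (hf : Tst f) (S : ℝ) (hS : 0 ≤ S) :
    ∃ C, 0 ≤ C ∧ ∀ s, 0 ≤ s → s ≤ S → ∀ x, ‖hfl f s x‖ ≤ C * ((1 + ‖x‖) ^ 4)⁻¹ := by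
  obtain ⟨M, hM0, hM⟩ := hf.bdd4
  have hI : 0 ≤ ∫ y : R3, gau y * (1 + ‖y‖) ^ 4 :=
    integral_nonneg fun y => mul_nonneg (gau_nonneg y) (by positivity)
  refine ⟨(∫ y : R3, gau y * (1 + ‖y‖) ^ 4) * ((1 + S) ^ 4 * M), by positivity, ?_⟩
  intro s hs hsS x
  rw [← div_eq_mul_inv, ← integral_mul_const, ← integral_div]
  refine norm_integral_le_of_norm_le ((gau_int4.mul_const _).div_const _)
    (Filter.Eventually.of_forall fun y => ?_)
  rw [norm_smul, Real.norm_of_nonneg (gau_nonneg y), mul_assoc, mul_div_assoc]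
  refine mul_le_mul_of_nonneg_left ?_ (gau_nonneg y)
  rw [le_div_iff₀ (by positivity)]
  have h1 : 1 + ‖x‖ ≤ (1 + ‖x + s • y‖) * ((1 + S) * (1 + ‖y‖)) := by
    have h2 : ‖x‖ ≤ ‖x + s • y‖ + s * ‖y‖ := by
      have := norm_sub_le (x + s • y) (s • y)
      rwa [add_sub_cancel_right, norm_smul, Real.norm_of_nonneg hs] at this
    have h3 : s * ‖y‖ ≤ S * ‖y‖ := by gcongr
    have := norm_nonneg (x + s • y)
    have := norm_nonneg y
    have h5 : 0 ≤ S * ‖y‖ := by positivity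
    have h6 : 0 ≤ ‖x + s • y‖ * (S + ‖y‖ + S * ‖y‖) := by positivity
    nlinarith
  calc ‖f (x + s • y)‖ * (1 + ‖x‖) ^ 4
      ≤ ‖f (x + s • y)‖ * ((1 + ‖x + s • y‖) * ((1 + S) * (1 + ‖y‖))) ^ 4 := by gcongr
    _ = ((1 + ‖x + s • y‖) ^ 4 * ‖f (x + s • y)‖) * ((1 + S) ^ 4 * (1 + ‖y‖) ^ 4) := by ring
    _ ≤ M * ((1 + S) ^ 4 * (1 + ‖y‖) ^ 4) := by gcongr; exact hM _
    _ = _ := by ring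

lemma hfl_sup {f : R3 → V} (hf : Tst f) (s : ℝ) (hs : 0 < s) (x : R3) :
    ‖hfl f s x‖ ≤ gz⁻¹ * (s ^ 3)⁻¹ * ∫ y, ‖f y‖ := by
  have hgz := gz_pos
  have h1 : Integrable (fun y : R3 => ‖f (x + s • y)‖) := by
    have : Integrable (fun y : R3 => ‖f (x + y)‖) := (hf.integrable.norm).comp_add_left x
    exact this.comp_smul hs.ne'
  calc ‖hfl f s x‖ ≤ ∫ y : R3, gz⁻¹ * ‖f (x + s • y)‖ := by
        refine norm_integral_le_of_norm_le (h1.const_mul _)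
          (Filter.Eventually.of_forall fun y => ?_)
        rw [norm_smul, Real.norm_of_nonneg (gau_nonneg y)]
        exact mul_le_mul_of_nonneg_right (gau_le y) (norm_nonneg _)
    _ = _ := by
        rw [integral_const_mul]
        have := Measure.integral_comp_smul_of_nonneg (volume : Measure R3)
          (fun y : R3 => ‖f (x + y)‖) s (hR := hs.le)
        rw [this, integral_add_left_eq_self (fun y => ‖f y‖) x]
        simp [mul_assoc]

lemma hfl_l1 {f : R3 → V} (hf : Tst f) (s : ℝ) :
    ∫ x, ‖hfl f s x‖ ≤ ∫ y, ‖f y‖ := by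
  have := hf.cont; have := gau_cont
  have hI : Integrable (Function.uncurry fun (y x : R3) => gau y * ‖f (x + s • y)‖)
      (volume.prod volume) := by
    rw [integrable_prod_iff (by apply Continuous.aestronglyMeasurable; fun_prop)]
    refine ⟨Filter.Eventually.of_forall fun y => ?_, ?_⟩
    · exact (hf.integrable.norm.comp_add_right (s • y)).const_mul (gau y)
    · simp only [Function.uncurry, norm_mul, norm_norm]
      simp_rw [integral_const_mul, integral_add_right_eq_self (fun y => ‖f y‖)]
      exact gau_int.norm.mul_const _
  calc ∫ x, ‖hfl f s x‖ ≤ ∫ x, ∫ y, gau y * ‖f (x + s • y)‖ := by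
        refine integral_mono_of_nonneg (Filter.Eventually.of_forall fun x => norm_nonneg _)
          hI.integral_prod_right (Filter.Eventually.of_forall fun x => ?_)
        refine (norm_integral_le_integral_norm _).trans (le_of_eq ?_)
        refine integral_congr_ae (Filter.Eventually.of_forall fun y => ?_)
        simp only [norm_smul, Real.norm_of_nonneg (gau_nonneg y)]
    _ = ∫ y, ∫ x, gau y * ‖f (x + s • y)‖ := (integral_integral_swap hI).symm
    _ = _ := by
        simp_rw [integral_const_mul, integral_add_right_eq_self (fun y => ‖f y‖)]
        rw [integral_mul_const, gau_integral, one_mul]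

lemma hfl_sum {ι : Type*} (I : Finset ι) (F : ι → R3 → V) (hF : ∀ i ∈ I, Tst (F i)) (s : ℝ)
    (x : R3) : hfl (fun z => ∑ i ∈ I, F i z) s x = ∑ i ∈ I, hfl (F i) s x := by
  unfold hfl
  simp_rw [Finset.smul_sum]
  exact integral_finsetSum _ fun i hi => hfl_integrand (hF i hi) s x

lemma hfl_clm (A : V →L[ℝ] V) {f : R3 → V} (hf : Tst f) (s : ℝ) (x : R3) :
    hfl (fun z => A (f z)) s x = A (hfl f s x) := by
  unfold hfl
  rw [← A.integral_comp_comm (hfl_integrand hf s x)]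
  simp

end HeatFlow

section Bellman

/-- Bellman function and its derivatives -/
def bF (K p θ m a b : ℝ) : ℝ := K * a ^ (p / 2) + b * (a + b ^ m) ^ θ
def bFa (K p θ m a b : ℝ) : ℝ :=
  K * ((p / 2) * a ^ (p / 2 - 1)) + θ * (b * (a + b ^ m) ^ (θ - 1))
def bFb (θ m a b : ℝ) : ℝ :=
  (a + b ^ m) ^ θ + θ * (m * (b ^ m * (a + b ^ m) ^ (θ - 1)))
def bFaa (K p θ m a b : ℝ) : ℝ :=
  K * ((p / 2) * ((p / 2 - 1) * a ^ (p / 2 - 1 - 1))) +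
    θ * (b * ((θ - 1) * (a + b ^ m) ^ (θ - 1 - 1)))
def bFab (θ m a b : ℝ) : ℝ :=
  θ * (a + b ^ m) ^ (θ - 1) + θ * (m * (b ^ m * ((θ - 1) * (a + b ^ m) ^ (θ - 1 - 1))))
def bFbb (θ m a b : ℝ) : ℝ :=
  θ * (m * b ^ (m - 1) * (a + b ^ m) ^ (θ - 1)) +
    θ * (m * (m * b ^ (m - 1) * (a + b ^ m) ^ (θ - 1) +
      b ^ m * ((θ - 1) * (m * b ^ (m - 1)) * (a + b ^ m) ^ (θ - 1 - 1))))

variable {K p θ m : ℝ} {a b : ℝ → ℝ} {a' b' t : ℝ}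

lemma bW_deriv (e : ℝ) (ha : HasDerivAt a a' t) (hb : HasDerivAt b b' t) (ha0 : 0 < a t)
    (hb0 : 0 < b t) : HasDerivAt (fun t => (a t + b t ^ m) ^ e)
      ((a' + b' * m * b t ^ (m - 1)) * e * (a t + b t ^ m) ^ (e - 1)) t := by
  have h1 := ha.add (hb.rpow_const (p := m) (Or.inl hb0.ne'))
  refine h1.rpow_const (Or.inl ?_)
  have : 0 < b t ^ m := Real.rpow_pos_of_pos hb0 _
  simp only [Pi.add_apply]
  positivity

lemma bF_deriv (ha : HasDerivAt a a' t) (hb : HasDerivAt b b' t) (ha0 : 0 < a t)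
    (hb0 : 0 < b t) : HasDerivAt (fun t => bF K p θ m (a t) (b t))
      (bFa K p θ m (a t) (b t) * a' + bFb θ m (a t) (b t) * b') t := by
  have h1 := ((ha.rpow_const (p := p / 2) (Or.inl ha0.ne')).const_mul K).add
    (hb.mul (bW_deriv (m := m) θ ha hb ha0 hb0))
  refine h1.congr_deriv ?_
  unfold bFa bFb
  rw [Real.rpow_sub_one hb0.ne' m]
  field_simp
  ring

lemma bFa_deriv (ha : HasDerivAt a a' t) (hb : HasDerivAt b b' t) (ha0 : 0 < a t)
    (hb0 : 0 < b t) : HasDerivAt (fun t => bFa K p θ m (a t) (b t))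
      (bFaa K p θ m (a t) (b t) * a' + bFab θ m (a t) (b t) * b') t := by
  have h1 := (((ha.rpow_const (p := p / 2 - 1) (Or.inl ha0.ne')).const_mul (p / 2)).const_mul K).add
    ((hb.mul (bW_deriv (m := m) (θ - 1) ha hb ha0 hb0)).const_mul θ)
  refine h1.congr_deriv ?_
  unfold bFaa bFab
  rw [Real.rpow_sub_one hb0.ne' m]
  field_simp
  ring

lemma bFb_deriv (ha : HasDerivAt a a' t) (hb : HasDerivAt b b' t) (ha0 : 0 < a t)
    (hb0 : 0 < b t) : HasDerivAt (fun t => bFb θ m (a t) (b t))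
      (bFab θ m (a t) (b t) * a' + bFbb θ m (a t) (b t) * b') t := by
  have h1 := (bW_deriv (m := m) θ ha hb ha0 hb0).add
    ((((hb.rpow_const (p := m) (Or.inl hb0.ne')).mul
      (bW_deriv (m := m) (θ - 1) ha hb ha0 hb0)).const_mul m).const_mul θ)
  refine h1.congr_deriv ?_
  unfold bFab bFbb
  ring

section cont
variable {X : Type*} [TopologicalSpace X] {f g : X → ℝ}

lemma bW_cont (hf : Continuous f) (hg : Continuous g) (hf0 : ∀ x, 0 < f x) (hg0 : ∀ x, 0 < g x)
    (e : ℝ) : Continuous (fun x => (f x + g x ^ m) ^ e) := by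
  refine Continuous.rpow_const (hf.add (hg.rpow_const fun x => Or.inl (hg0 x).ne')) fun x =>
    Or.inl ?_
  have : 0 < g x ^ m := Real.rpow_pos_of_pos (hg0 x) _
  have := hf0 x
  positivity

lemma bR_cont (hf : Continuous f) (hf0 : ∀ x, 0 < f x) (e : ℝ) :
    Continuous (fun x => f x ^ e) := hf.rpow_const fun x => Or.inl (hf0 x).ne'

lemma bF_cont (hf : Continuous f) (hg : Continuous g) (hf0 : ∀ x, 0 < f x) (hg0 : ∀ x, 0 < g x) :
    Continuous (fun x => bF K p θ m (f x) (g x)) ∧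
    Continuous (fun x => bFa K p θ m (f x) (g x)) ∧
    Continuous (fun x => bFb θ m (f x) (g x)) ∧
    Continuous (fun x => bFaa K p θ m (f x) (g x)) ∧
    Continuous (fun x => bFab θ m (f x) (g x)) ∧
    Continuous (fun x => bFbb θ m (f x) (g x)) := by
  have h1 := bW_cont (m := m) hf hg hf0 hg0
  have h2 := bR_cont hf hf0
  have h3 := bR_cont hg hg0
  unfold bF bFa bFb bFaa bFab bFbb
  refine ⟨?_, ?_, ?_, ?_, ?_, ?_⟩ <;> fun_prop

lemma bF_bdd (K p θ m ε M : ℝ) (hε : 0 < ε) : ∃ C, 0 ≤ C ∧ ∀ a b, ε ≤ a → a ≤ M → ε ≤ b → b ≤ M →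
    |bFa K p θ m a b| ≤ C ∧ |bFb θ m a b| ≤ C ∧ |bFaa K p θ m a b| ≤ C ∧
    |bFab θ m a b| ≤ C ∧ |bFbb θ m a b| ≤ C := by
  have hc := bF_cont (X := Set.Icc ε M × Set.Icc ε M) (K := K) (p := p) (θ := θ) (m := m)
    (f := fun z => (z.1 : ℝ)) (g := fun z => (z.2 : ℝ)) (by fun_prop) (by fun_prop)
    (fun z => hε.trans_le z.1.2.1) (fun z => hε.trans_le z.2.2.1)
  have key : ∀ F : Set.Icc ε M × Set.Icc ε M → ℝ, Continuous F → ∃ C, ∀ z, |F z| ≤ C := by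
    intro F hF
    obtain ⟨C, hC⟩ := isCompact_univ.exists_bound_of_continuousOn hF.continuousOn
    exact ⟨C, fun z => hC z (Set.mem_univ z)⟩
  obtain ⟨-, h1, h2, h3, h4, h5⟩ := hc
  obtain ⟨C1, h1⟩ := key _ h1
  obtain ⟨C2, h2⟩ := key _ h2
  obtain ⟨C3, h3⟩ := key _ h3
  obtain ⟨C4, h4⟩ := key _ h4
  obtain ⟨C5, h5⟩ := key _ h5
  refine ⟨|C1| + |C2| + |C3| + |C4| + |C5|, by positivity, fun a b h6 h7 h8 h9 => ?_⟩
  have i1 := h1 (⟨a, h6, h7⟩, ⟨b, h8, h9⟩)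
  have i2 := h2 (⟨a, h6, h7⟩, ⟨b, h8, h9⟩)
  have i3 := h3 (⟨a, h6, h7⟩, ⟨b, h8, h9⟩)
  have i4 := h4 (⟨a, h6, h7⟩, ⟨b, h8, h9⟩)
  have i5 := h5 (⟨a, h6, h7⟩, ⟨b, h8, h9⟩)
  simp only at i1 i2 i3 i4 i5
  have := le_abs_self C1
  have := le_abs_self C2
  have := le_abs_self C3
  have := le_abs_self C4
  have := le_abs_self C5
  have := abs_nonneg C1
  have := abs_nonneg C2
  have := abs_nonneg C3
  have := abs_nonneg C4
  have := abs_nonneg C5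
  refine ⟨?_, ?_, ?_, ?_, ?_⟩ <;> linarith
end cont

set_option maxHeartbeats 2000000 in
/-- The pointwise Bellman inequality. -/
lemma bellman_ineq (p : ℝ) (hp : 1 < p) (hp2 : p ≤ 2) (a b X Y A B : ℝ) (ha : 0 < a) (hb : 0 < b)
    (hX : 0 ≤ X) (hY : 0 ≤ Y) (hA : A ^ 2 ≤ 4 * a * X ^ 2) (hB : B ^ 2 ≤ 4 * b * Y ^ 2)
    (K θ m : ℝ) (hm : m = 1 / (p - 1)) (hθ : θ = 1 - p / 2)
    (hK : K = (2 + 16 * m ^ 2) / (p * (p - 1))) :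
    ((a + b ^ m) ^ θ)⁻¹ * X ^ 2 + (a + b ^ m) ^ θ * Y ^ 2 ≤
      2 * bFa K p θ m a b * X ^ 2 + 2 * bFb θ m a b * Y ^ 2 + bFaa K p θ m a b * A ^ 2 +
        2 * bFab θ m a b * A * B + bFbb θ m a b * B ^ 2 := by
  have hp1 : 0 < p - 1 := by linarith
  have hm1 : 1 ≤ m := by rw [hm, le_div_iff₀ hp1]; linarith
  have hθ0 : 0 ≤ θ := by rw [hθ]; linarith
  have hθ1 : θ ≤ 1 / 2 := by rw [hθ]; linarith
  have hc : 0 < b ^ m := Real.rpow_pos_of_pos hb _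
  have hbm : (b ^ m) ^ (p - 1) = b := by
    rw [← Real.rpow_mul hb.le, hm]; field_simp; simp
  set c := b ^ m with hcdef
  set w := a + c with hw
  have hw0 : 0 < w := by positivity
  have hW0 : 0 < w ^ θ := Real.rpow_pos_of_pos hw0 _
  have hbW : b * (w ^ θ) ^ 2 ≤ w := by
    have h1 : b ≤ w ^ (p - 1) := by
      rw [← hbm]; exact Real.rpow_le_rpow hc.le (by linarith) hp1.le
    calc b * (w ^ θ) ^ 2 ≤ w ^ (p - 1) * (w ^ θ) ^ 2 := by gcongr
      _ = w ^ (p - 1) * w ^ (θ * 2) := by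
        rw [← Real.rpow_natCast (w ^ θ), ← Real.rpow_mul hw0.le]; norm_num
      _ = w := by rw [← Real.rpow_add hw0, hθ]; ring_nf; simp
  have hα : a ^ (p / 2 - 1) = (a ^ θ)⁻¹ := by
    rw [← Real.rpow_neg ha.le, hθ]; ring_nf
  have haθ : 0 < a ^ θ := Real.rpow_pos_of_pos ha _
  have hαW : (w ^ θ)⁻¹ ≤ (a ^ θ)⁻¹ := by
    refine inv_anti₀ haθ (Real.rpow_le_rpow ha.le (by linarith) hθ0)
  have e1 : w ^ (θ - 1) = w ^ θ / w := Real.rpow_sub_one hw0.ne' _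
  have e2 : w ^ (θ - 1 - 1) = w ^ θ / w / w := by rw [Real.rpow_sub_one hw0.ne', e1]
  have e3 : b ^ (m - 1) = c / b := Real.rpow_sub_one hb.ne' _
  have e4 : a ^ (p / 2 - 1 - 1) = (a ^ θ)⁻¹ / a := by rw [Real.rpow_sub_one ha.ne', hα]
  unfold bFa bFb bFaa bFab bFbb
  rw [← hcdef, ← hw, e1, e2, e3, e4, hα]
  set W := w ^ θ with hWdef
  set α := (a ^ θ)⁻¹ with hαdef
  have hα0 : 0 < α := by positivity
  have hK0 : 0 < K := by rw [hK]; positivity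
  have hKp : K * p * (p - 1) = 2 + 16 * m ^ 2 := by rw [hK]; field_simp
  have hX2 := sq_nonneg X
  have hY2 := sq_nonneg Y
  -- the `a ^ (p/2)` part
  have P1 : (2 + 16 * m ^ 2) * (W⁻¹ * X ^ 2) ≤
      2 * (K * (p / 2 * α)) * X ^ 2 + K * (p / 2 * ((p / 2 - 1) * (α / a))) * A ^ 2 := by
    have h1 : α / a * A ^ 2 ≤ 4 * α * X ^ 2 := by
      rw [div_mul_eq_mul_div, div_le_iff₀ ha]
      nlinarith
    have h2 : K * p * (p - 1) * (W⁻¹ * X ^ 2) ≤ K * p * (p - 1) * (α * X ^ 2) := by gcongr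
    have h3 : K * (p / 2) * (1 - p / 2) * (α / a * A ^ 2) ≤
        K * (p / 2) * (1 - p / 2) * (4 * α * X ^ 2) := by
      have : 0 ≤ 1 - p / 2 := by linarith
      gcongr
    rw [← hKp]
    linarith
  -- `G_aa` part
  have P2 : -(W⁻¹ * X ^ 2) ≤ θ * (b * ((θ - 1) * (W / w / w))) * A ^ 2 := by
    have h1 : θ * (1 - θ) ≤ 1 / 4 := by nlinarith [sq_nonneg (θ - 1 / 2)]
    have h2 : b * (W / w / w) * A ^ 2 ≤ 4 * (W⁻¹ * X ^ 2) := by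
      calc b * (W / w / w) * A ^ 2 ≤ b * (W / w / w) * (4 * a * X ^ 2) := by gcongr
        _ = 4 * (b * W ^ 2) * a / (w * w) * (W⁻¹ * X ^ 2) := by field_simp
        _ ≤ 4 * (W⁻¹ * X ^ 2) := by
          gcongr
          rw [div_le_iff₀ (by positivity)]
          have : a ≤ w := by linarith
          have h5 : b * W ^ 2 * a ≤ w * w := by gcongr
          linarith
    have h3 : 0 ≤ b * (W / w / w) * A ^ 2 := by positivity
    have h4 : θ * (1 - θ) * (b * (W / w / w) * A ^ 2) ≤ 1 / 4 * (4 * (W⁻¹ * X ^ 2)) := by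
      gcongr
    linarith
  -- `G_a` and `G_b`
  have P3 : 0 ≤ 2 * (θ * (b * (W / w))) * X ^ 2 := by positivity
  have P4 : 2 * (W * Y ^ 2) ≤ 2 * (W + θ * (m * (c * (W / w)))) * Y ^ 2 := by
    have : 0 ≤ θ * (m * (c * (W / w))) * Y ^ 2 := by positivity
    linarith
  -- `G_bb`
  have P5 : 0 ≤ (θ * (m * (c / b) * (W / w)) + θ * (m * (m * (c / b) * (W / w) +
      c * ((θ - 1) * (m * (c / b)) * (W / w / w))))) * B ^ 2 := by
    have h1 : 0 ≤ m * (c / b) * (W / w) + c * ((θ - 1) * (m * (c / b)) * (W / w / w)) := by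
      have : m * (c / b) * (W / w) + c * ((θ - 1) * (m * (c / b)) * (W / w / w)) =
          m * (c / b) * (W / w / w) * (a + θ * c) := by
        rw [hw]; field_simp; ring
      rw [this]; positivity
    positivity
  -- cross term
  have P6 : -(16 * m ^ 2 * (W⁻¹ * X ^ 2) + W * Y ^ 2) ≤
      2 * (θ * (W / w) + θ * (m * (c * ((θ - 1) * (W / w / w))))) * A * B := by
    have h1 : |A * B| ≤ 4 * (w / W) * (X * Y) := by
      refine abs_le_of_sq_le_sq ?_ (by positivity)
      have h5 : a * b ≤ (w / W) ^ 2 := by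
        rw [div_pow, le_div_iff₀ (by positivity)]
        calc a * b * W ^ 2 = a * (b * W ^ 2) := by ring
          _ ≤ w * w := by gcongr; linarith
          _ = w ^ 2 := by ring
      calc (A * B) ^ 2 = A ^ 2 * B ^ 2 := by ring
        _ ≤ (4 * a * X ^ 2) * (4 * b * Y ^ 2) := by gcongr
        _ = 16 * (a * b) * (X * Y) ^ 2 := by ring
        _ ≤ 16 * (w / W) ^ 2 * (X * Y) ^ 2 := by gcongr
        _ = _ := by ring
    have h2 : |θ * (W / w) + θ * (m * (c * ((θ - 1) * (W / w / w))))| ≤ m * (W / w) := by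
      have h6 : 0 ≤ c / w := by positivity
      have h7 : c / w ≤ 1 := by rw [div_le_one hw0]; linarith
      have e : θ * (W / w) + θ * (m * (c * ((θ - 1) * (W / w / w)))) =
          (θ * (1 - m * (1 - θ) * (c / w))) * (W / w) := by
        field_simp; ring
      have h9 : 0 ≤ (1 - θ) * (c / w) := mul_nonneg (by linarith) h6
      have h10 : (1 - θ) * (c / w) ≤ 1 := mul_le_one₀ (by linarith) h6 h7
      rw [e, abs_mul, abs_of_pos (by positivity : 0 < W / w)]
      gcongr
      rw [abs_mul, abs_of_nonneg hθ0]
      have h8 : |1 - m * (1 - θ) * (c / w)| ≤ m := by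
        rw [abs_le, mul_assoc]; constructor <;> nlinarith
      calc θ * _ ≤ 1 * m := by gcongr; linarith
        _ = m := one_mul m
    have h3 : |2 * (θ * (W / w) + θ * (m * (c * ((θ - 1) * (W / w / w))))) * A * B| ≤
        8 * m * (X * Y) := by
      rw [mul_assoc, abs_mul, abs_mul, abs_two]
      calc _ ≤ 2 * (m * (W / w)) * (4 * (w / W) * (X * Y)) := by gcongr
        _ = _ := by field_simp; ring
    have h4 : 8 * m * (X * Y) ≤ 16 * m ^ 2 * (W⁻¹ * X ^ 2) + W * Y ^ 2 := by
      have : 16 * m ^ 2 * (W⁻¹ * X ^ 2) + W * Y ^ 2 - 8 * m * (X * Y) =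
          W⁻¹ * (4 * m * X - W * Y) ^ 2 := by field_simp; ring
      have : 0 ≤ W⁻¹ * (4 * m * X - W * Y) ^ 2 := by positivity
      linarith
    have := neg_abs_le (2 * (θ * (W / w) + θ * (m * (c * ((θ - 1) * (W / w / w))))) * A * B)
    linarith
  linarith

lemma bF_upper (p : ℝ) (hp : 1 < p) (hp2 : p ≤ 2) (a b : ℝ) (ha : 0 < a) (hb : 0 < b)
    (K θ m q : ℝ) (hm : m = 1 / (p - 1)) (hθ : θ = 1 - p / 2) (hq : q = p / (p - 1)) :
    bF K p θ m a b ≤ (K + 1) * a ^ (p / 2) + b ^ (q / 2) := by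
  have hp1 : 0 < p - 1 := by linarith
  have hc : 0 < b ^ m := Real.rpow_pos_of_pos hb _
  have hbm : (b ^ m) ^ (p - 1) = b := by
    rw [← Real.rpow_mul hb.le, hm]; field_simp; simp
  have hbq : (b ^ m) ^ (p / 2) = b ^ (q / 2) := by
    rw [← Real.rpow_mul hb.le, hm, hq]; congr 1; field_simp
  have h0 : 0 < a + b ^ m := by positivity
  have h1 : b ≤ (a + b ^ m) ^ (p - 1) := by
    conv_lhs => rw [← hbm]
    exact Real.rpow_le_rpow hc.le (by linarith) hp1.le
  have h2 : b * (a + b ^ m) ^ θ ≤ (a + b ^ m) ^ (p / 2) := by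
    calc b * (a + b ^ m) ^ θ ≤ (a + b ^ m) ^ (p - 1) * (a + b ^ m) ^ θ := by gcongr
      _ = _ := by rw [← Real.rpow_add h0, hθ]; ring_nf
  have h3 : (a + b ^ m) ^ (p / 2) ≤ a ^ (p / 2) + (b ^ m) ^ (p / 2) :=
    Real.rpow_add_le_add_rpow ha.le hc.le (by linarith) (by linarith)
  unfold bF
  rw [hbq] at h3
  linarith

lemma bF_mono (hK : 0 ≤ K) (hp : 0 ≤ p) (hθ : 0 ≤ θ) (hm : 0 ≤ m) {a₀ b₀ a b : ℝ} (ha0 : 0 < a₀)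
    (hb0 : 0 < b₀) (ha : a₀ ≤ a) (hb : b₀ ≤ b) : bF K p θ m a₀ b₀ ≤ bF K p θ m a b := by
  unfold bF
  have : 0 < b₀ ^ m := Real.rpow_pos_of_pos hb0 _
  gcongr
  exact hb0.le.trans hb

lemma bF_nonneg (hK : 0 ≤ K) {a b : ℝ} (ha0 : 0 < a) (hb0 : 0 < b) : 0 ≤ bF K p θ m a b := by
  unfold bF
  positivity

end Bellman

section Flow

variable {V : Type*} [NormedAddCommGroup V] [InnerProductSpace ℝ V] [FiniteDimensional ℝ V]

/-- jointly continuous and uniformly decaying on `[0,S]` -/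
def Dec {W : Type*} [NormedAddCommGroup W] (S : ℝ) (F : ℝ → R3 → W) : Prop :=
  Continuous (fun z : ℝ × R3 => F z.1 z.2) ∧
    ∃ C, 0 ≤ C ∧ ∀ s, 0 ≤ s → s ≤ S → ∀ x, ‖F s x‖ ≤ C * ((1 + ‖x‖) ^ 4)⁻¹

/-- jointly continuous and bounded on `[0,S]` -/
def Bdd (S : ℝ) (F : ℝ → R3 → ℝ) : Prop :=
  Continuous (fun z : ℝ × R3 => F z.1 z.2) ∧
    ∃ C, 0 ≤ C ∧ ∀ s, 0 ≤ s → s ≤ S → ∀ x, ‖F s x‖ ≤ C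

lemma jap_le (x : R3) : ((1 + ‖x‖) ^ 4)⁻¹ ≤ 1 :=
  inv_le_one_of_one_le₀ (one_le_pow₀ (by linarith [norm_nonneg x]))

lemma Dec.bdd {S : ℝ} {F : ℝ → R3 → ℝ} (h : Dec S F) : Bdd S F := by
  obtain ⟨hc, C, hC0, hC⟩ := h
  refine ⟨hc, C, hC0, fun s h1 h2 x => (hC s h1 h2 x).trans ?_⟩
  exact mul_le_of_le_one_right hC0 (jap_le x)

lemma Dec.add {S : ℝ} {F G : ℝ → R3 → ℝ} (hF : Dec S F) (hG : Dec S G) :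
    Dec S (fun s x => F s x + G s x) := by
  obtain ⟨hc, C, hC0, hC⟩ := hF
  obtain ⟨hd, D, hD0, hD⟩ := hG
  refine ⟨hc.add hd, C + D, by positivity, fun s h1 h2 x => ?_⟩
  rw [add_mul]
  exact (norm_add_le _ _).trans (add_le_add (hC s h1 h2 x) (hD s h1 h2 x))

lemma Dec.sum {S : ℝ} {ι : Type*} (I : Finset ι) {F : ι → ℝ → R3 → ℝ} (hF : ∀ i, Dec S (F i)) :
    Dec S (fun s x => ∑ i ∈ I, F i s x) := by
  classical
  induction I using Finset.induction_on with
  | empty => exact ⟨by simpa using continuous_const, 0, le_rfl, by simp⟩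
  | insert i I hi ih =>
    simp only [Finset.sum_insert hi]
    exact (hF i).add ih

lemma Dec.bmul {S : ℝ} {F G : ℝ → R3 → ℝ} (hF : Bdd S F) (hG : Dec S G) :
    Dec S (fun s x => F s x * G s x) := by
  obtain ⟨hc, C, hC0, hC⟩ := hF
  obtain ⟨hd, D, hD0, hD⟩ := hG
  refine ⟨hc.mul hd, C * D, by positivity, fun s h1 h2 x => ?_⟩
  rw [norm_mul, mul_assoc]
  exact mul_le_mul (hC s h1 h2 x) (hD s h1 h2 x) (norm_nonneg _) hC0

lemma Dec.cmul {S : ℝ} {G : ℝ → R3 → ℝ} (c : ℝ) (hG : Dec S G) :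
    Dec S (fun s x => c * G s x) :=
  Dec.bmul (F := fun _ _ => c) ⟨continuous_const, ‖c‖, norm_nonneg _, fun _ _ _ _ => le_rfl⟩ hG

lemma Dec.norm {S : ℝ} {F : ℝ → R3 → V} (hF : Dec S F) : Dec S (fun s x => ‖F s x‖) := by
  obtain ⟨hc, C, hC0, hC⟩ := hF
  exact ⟨hc.norm, C, hC0, fun s h1 h2 x => by simpa using hC s h1 h2 x⟩

lemma Dec.inner {S : ℝ} {F G : ℝ → R3 → V} (hF : Dec S F) (hG : Dec S G) :
    Dec S (fun s x => inner ℝ (F s x) (G s x)) := by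
  obtain ⟨-, D, hD0, hD⟩ := Dec.bmul hF.norm.bdd hG.norm
  refine ⟨hF.1.inner hG.1, D, hD0, fun s h1 h2 x => (norm_inner_le_norm _ _).trans ?_⟩
  have := hD s h1 h2 x
  rwa [Real.norm_of_nonneg (by positivity)] at this

lemma Dec.integrable {W : Type*} [NormedAddCommGroup W] {S : ℝ} {F : ℝ → R3 → W} (hF : Dec S F)
    (s : ℝ) (h0 : 0 ≤ s) (h1 : s ≤ S) : Integrable (F s) := by
  obtain ⟨hc, C, hC0, hC⟩ := hF
  refine (jap_int.const_mul C).mono' ?_ (Filter.Eventually.of_forall fun x => hC s h0 h1 x)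
  exact (hc.comp (by fun_prop : Continuous fun x : R3 => (s, x))).aestronglyMeasurable

lemma Dec.integrable_prod {S : ℝ} {F : ℝ → R3 → ℝ} (hF : Dec S F) :
    Integrable (fun z : ℝ × R3 => z.1 * F z.1 z.2)
      ((volume.restrict (Set.Ioc 0 S)).prod volume) := by
  obtain ⟨hc, C, hC0, hC⟩ := hF
  have h1 : Integrable (fun _ : ℝ => S * C) (volume.restrict (Set.Ioc 0 S)) :=
    integrable_const _
  refine (h1.mul_prod jap_int).mono' (continuous_fst.mul hc).aestronglyMeasurable ?_
  have e : (volume.restrict (Set.Ioc 0 S)).prod (volume : Measure R3) =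
      (volume.prod volume).restrict (Set.Ioc 0 S ×ˢ Set.univ) := by
    rw [← Measure.prod_restrict, Measure.restrict_univ]
  rw [e]
  refine (ae_restrict_iff' (measurableSet_Ioc.prod MeasurableSet.univ)).2
    (Filter.Eventually.of_forall fun z hz => ?_)
  have hz1 : 0 < z.1 ∧ z.1 ≤ S := hz.1
  rw [norm_mul, Real.norm_of_nonneg hz1.1.le, mul_assoc]
  exact mul_le_mul hz1.2 (hC z.1 hz1.1.le hz1.2 z.2) (norm_nonneg _) (hz1.1.le.trans hz1.2)

lemma Dec.intervalIntegrable {S : ℝ} (hS : 0 ≤ S) {F : ℝ → R3 → ℝ} (hF : Dec S F) :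
    IntervalIntegrable (fun s => s * ∫ x, F s x) volume 0 S := by
  rw [intervalIntegrable_iff_integrableOn_Ioc_of_le hS]
  have := hF.integrable_prod.integral_prod_left
  simp only [integral_const_mul] at this
  exact this

lemma flux {S : ℝ} (hS : 0 ≤ S) {F L : ℝ → R3 → ℝ} (hL : Dec S L)
    (hF : ∀ s x, HasDerivAt (fun s => F s x) (s * L s x) s) :
    Integrable (fun x => F S x - F 0 x) ∧
      ∫ x, (F S x - F 0 x) = ∫ s in (0 : ℝ)..S, s * ∫ x, L s x := by
  have e : ∀ x, F S x - F 0 x = ∫ s in Set.Ioc 0 S, s * L s x := by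
    intro x
    rw [← intervalIntegral.integral_of_le hS]
    refine (intervalIntegral.integral_eq_sub_of_hasDerivAt (fun s _ => hF s x) ?_).symm
    refine Continuous.intervalIntegrable ?_ _ _
    exact continuous_id.mul (hL.1.comp (by fun_prop : Continuous fun s : ℝ => (s, x)))
  refine ⟨?_, ?_⟩
  · simp_rw [e]
    exact hL.integrable_prod.integral_prod_right
  · simp_rw [e]
    rw [intervalIntegral.integral_of_le hS]
    have := integral_integral_swap (f := fun s x => s * L s x) hL.integrable_prod
    rw [← this]
    simp_rw [integral_const_mul]

lemma integral_line_zero {v v' : R3 → ℝ} (e : R3) (h : ∀ x, HasLineDerivAt ℝ v (v' x) x e)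
    (hv : Integrable v) (hv' : Integrable v') : ∫ x, v' x = 0 := by
  have := integral_bilinear_hasLineDerivAt_right_eq_neg_left_of_integrable (μ := volume)
    (f := fun _ : R3 => (1 : ℝ)) (f' := fun _ => 0) (g := v) (g' := v') (v := e)
    (B := ContinuousLinearMap.lsmul ℝ ℝ) (by simp) (by simpa using hv') (by simpa using hv)
    (fun x _ => by simpa [HasLineDerivAt] using hasDerivAt_const (0 : ℝ) (1 : ℝ)) (fun x _ => h x)
  simpa using this

lemma hfl_dec {f : R3 → V} (hf : Tst f) {S : ℝ} (hS : 0 ≤ S) : Dec S (hfl f) :=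
  ⟨hfl_cont hf, hfl_decay hf S hS⟩

lemma hfl_ibp {f g : R3 → V} (hf : Tst f) (hg : Tst g) (j : Fin 3) {s : ℝ} (hs : 0 ≤ s) :
    ∫ x, inner ℝ (hfl (dd j f) s x) (hfl g s x) =
      - ∫ x, inner ℝ (hfl f s x) (hfl (dd j g) s x) := by
  have d1 := ((hfl_dec (hf.dd j) hs).inner (hfl_dec hg hs)).integrable s hs le_rfl
  have d2 := ((hfl_dec hf hs).inner (hfl_dec (hg.dd j) hs)).integrable s hs le_rfl
  have d3 := ((hfl_dec hf hs).inner (hfl_dec hg hs)).integrable s hs le_rfl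
  have := integral_line_zero (eb j) (v := fun x => inner ℝ (hfl f s x) (hfl g s x))
    (v' := fun x => inner ℝ (hfl f s x) (hfl (dd j g) s x) +
      inner ℝ (hfl (dd j f) s x) (hfl g s x)) ?_ d3 (d2.add d1)
  · rw [integral_add d2 d1] at this
    linarith
  · intro x
    have h1 := hfl_dx hf j s x
    have h2 := hfl_dx hg j s x
    unfold HasLineDerivAt at *
    have := h1.inner ℝ h2
    simpa using this

/-- `‖f_s‖² + ε` -/
def sqe (ε : ℝ) (f : R3 → V) (s : ℝ) (x : R3) : ℝ := ‖hfl f s x‖ ^ 2 + ε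

lemma sqe_pos {ε : ℝ} (hε : 0 < ε) (f : R3 → V) (s : ℝ) (x : R3) : 0 < sqe ε f s x := by
  unfold sqe; positivity

lemma sqe_cont (ε : ℝ) {f : R3 → V} (hf : Tst f) :
    Continuous (fun z : ℝ × R3 => sqe ε f z.1 z.2) :=
  ((hfl_cont hf).norm.pow 2).add continuous_const

lemma sqe_bdd (ε : ℝ) {f : R3 → V} (hf : Tst f) {S : ℝ} (hS : 0 ≤ S) :
    ∃ M, ∀ s, 0 ≤ s → s ≤ S → ∀ x, sqe ε f s x ≤ M := by
  obtain ⟨-, C, hC0, hC⟩ := (hfl_dec hf hS).norm.bdd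
  refine ⟨C ^ 2 + ε, fun s h1 h2 x => ?_⟩
  unfold sqe
  have := hC s h1 h2 x
  rw [norm_norm] at this
  gcongr

lemma sqe_dx (ε : ℝ) {f : R3 → V} (hf : Tst f) (j : Fin 3) (s : ℝ) (x : R3) :
    HasLineDerivAt ℝ (sqe ε f s) (2 * inner ℝ (hfl f s x) (hfl (dd j f) s x)) x (eb j) := by
  have h1 := hfl_dx hf j s x
  unfold HasLineDerivAt at *
  have := (h1.norm_sq).add_const ε
  refine this.congr_deriv ?_
  simp

lemma sqe_ds (ε : ℝ) {f : R3 → V} (hf : Tst f) (s : ℝ) (x : R3) :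
    HasDerivAt (fun s => sqe ε f s x)
      (s * (2 * inner ℝ (hfl f s x) (∑ j, hfl (dd j (dd j f)) s x))) s := by
  have := ((hfl_ds hf s x).norm_sq).add_const ε
  refine this.congr_deriv ?_
  rw [inner_smul_right]
  ring

section bil
variable (K p θ m ε : ℝ) (f g : R3 → V)

/-- Bellman function along the flow -/
def bt (s : ℝ) (x : R3) : ℝ := bF K p θ m (sqe ε f s x) (sqe ε g s x)

/-- first derivative in direction `j` -/
def bt1 (j : Fin 3) (s : ℝ) (x : R3) : ℝ :=
  bFa K p θ m (sqe ε f s x) (sqe ε g s x) * (2 * inner ℝ (hfl f s x) (hfl (dd j f) s x)) +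
  bFb θ m (sqe ε f s x) (sqe ε g s x) * (2 * inner ℝ (hfl g s x) (hfl (dd j g) s x))

/-- Laplacian-type term -/
def btL (j : Fin 3) (s : ℝ) (x : R3) : ℝ :=
  bFa K p θ m (sqe ε f s x) (sqe ε g s x) *
    (2 * inner ℝ (hfl f s x) (hfl (dd j (dd j f)) s x)) +
  bFb θ m (sqe ε f s x) (sqe ε g s x) *
    (2 * inner ℝ (hfl g s x) (hfl (dd j (dd j g)) s x))

/-- Hessian term -/
def btQ (j : Fin 3) (s : ℝ) (x : R3) : ℝ :=
  bFa K p θ m (sqe ε f s x) (sqe ε g s x) *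
    (2 * inner ℝ (hfl (dd j f) s x) (hfl (dd j f) s x)) +
  bFb θ m (sqe ε f s x) (sqe ε g s x) *
    (2 * inner ℝ (hfl (dd j g) s x) (hfl (dd j g) s x)) +
  bFaa K p θ m (sqe ε f s x) (sqe ε g s x) *
    ((2 * inner ℝ (hfl f s x) (hfl (dd j f) s x)) *
      (2 * inner ℝ (hfl f s x) (hfl (dd j f) s x))) +
  2 * (bFab θ m (sqe ε f s x) (sqe ε g s x) *
    ((2 * inner ℝ (hfl f s x) (hfl (dd j f) s x)) *
      (2 * inner ℝ (hfl g s x) (hfl (dd j g) s x)))) +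
  bFbb θ m (sqe ε f s x) (sqe ε g s x) *
    ((2 * inner ℝ (hfl g s x) (hfl (dd j g) s x)) *
      (2 * inner ℝ (hfl g s x) (hfl (dd j g) s x)))

variable {K p θ m ε f g}

lemma bt_ds (hε : 0 < ε) (hf : Tst f) (hg : Tst g) (s : ℝ) (x : R3) :
    HasDerivAt (fun s => bt K p θ m ε f g s x) (s * ∑ j, btL K p θ m ε f g j s x) s := by
  have := bF_deriv (K := K) (p := p) (θ := θ) (m := m) (sqe_ds ε hf s x) (sqe_ds ε hg s x)
    (sqe_pos hε f s x) (sqe_pos hε g s x)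
  refine this.congr_deriv ?_
  unfold btL
  simp only [Fin.sum_univ_three, inner_add_right]
  ring

lemma bt1_dx (hε : 0 < ε) (hf : Tst f) (hg : Tst g) (j : Fin 3) (s : ℝ) (x : R3) :
    HasLineDerivAt ℝ (bt1 K p θ m ε f g j s)
      (btL K p θ m ε f g j s x + btQ K p θ m ε f g j s x) x (eb j) := by
  have ha := sqe_dx ε hf j s x
  have hb := sqe_dx ε hg j s x
  have f1 := hfl_dx hf j s x
  have f2 := hfl_dx (hf.dd j) j s x
  have g1 := hfl_dx hg j s x
  have g2 := hfl_dx (hg.dd j) j s x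
  unfold HasLineDerivAt at *
  have h1 := bFa_deriv (K := K) (p := p) (θ := θ) (m := m) ha hb
    (sqe_pos hε f s _) (sqe_pos hε g s _)
  have h2 := bFb_deriv (θ := θ) (m := m) ha hb (sqe_pos hε f s _) (sqe_pos hε g s _)
  have := (h1.mul ((f1.inner ℝ f2).const_mul 2)).add (h2.mul ((g1.inner ℝ g2).const_mul 2))
  refine this.congr_deriv ?_
  simp only [zero_smul, add_zero]
  unfold btL btQ
  ring

lemma bt_dec (hε : 0 < ε) (hf : Tst f) (hg : Tst g) {S : ℝ} (hS : 0 ≤ S) (j : Fin 3) :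
    Dec S (bt1 K p θ m ε f g j) ∧ Dec S (btL K p θ m ε f g j) ∧
      Dec S (btQ K p θ m ε f g j) := by
  obtain ⟨M1, hM1⟩ := sqe_bdd ε hf hS
  obtain ⟨M2, hM2⟩ := sqe_bdd ε hg hS
  obtain ⟨C, hC0, hC⟩ := bF_bdd K p θ m ε (max M1 M2) hε
  obtain ⟨-, c1, c2, c3, c4, c5⟩ := bF_cont (K := K) (p := p) (θ := θ) (m := m)
    (sqe_cont ε hf) (sqe_cont ε hg) (fun z => sqe_pos hε f z.1 z.2) (fun z => sqe_pos hε g z.1 z.2)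
  have hC' : ∀ s, 0 ≤ s → s ≤ S → ∀ x, _ := fun s h1 h2 x =>
    hC (sqe ε f s x) (sqe ε g s x) (by unfold sqe; nlinarith [sq_nonneg ‖hfl f s x‖])
      ((hM1 s h1 h2 x).trans (le_max_left _ _)) (by unfold sqe; nlinarith [sq_nonneg ‖hfl g s x‖])
      ((hM2 s h1 h2 x).trans (le_max_right _ _))
  have b1 : Bdd S (fun s x => bFa K p θ m (sqe ε f s x) (sqe ε g s x)) :=
    ⟨c1, C, hC0, fun s h1 h2 x => (hC' s h1 h2 x).1⟩
  have b2 : Bdd S (fun s x => bFb θ m (sqe ε f s x) (sqe ε g s x)) :=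
    ⟨c2, C, hC0, fun s h1 h2 x => (hC' s h1 h2 x).2.1⟩
  have b3 : Bdd S (fun s x => bFaa K p θ m (sqe ε f s x) (sqe ε g s x)) :=
    ⟨c3, C, hC0, fun s h1 h2 x => (hC' s h1 h2 x).2.2.1⟩
  have b4 : Bdd S (fun s x => bFab θ m (sqe ε f s x) (sqe ε g s x)) :=
    ⟨c4, C, hC0, fun s h1 h2 x => (hC' s h1 h2 x).2.2.2.1⟩
  have b5 : Bdd S (fun s x => bFbb θ m (sqe ε f s x) (sqe ε g s x)) :=
    ⟨c5, C, hC0, fun s h1 h2 x => (hC' s h1 h2 x).2.2.2.2⟩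
  have f0 := hfl_dec hf hS
  have f1 := hfl_dec (hf.dd j) hS
  have f2 := hfl_dec ((hf.dd j).dd j) hS
  have g0 := hfl_dec hg hS
  have g1 := hfl_dec (hg.dd j) hS
  have g2 := hfl_dec ((hg.dd j).dd j) hS
  refine ⟨?_, ?_, ?_⟩
  · exact (Dec.bmul b1 ((f0.inner f1).cmul 2)).add (Dec.bmul b2 ((g0.inner g1).cmul 2))
  · exact (Dec.bmul b1 ((f0.inner f2).cmul 2)).add (Dec.bmul b2 ((g0.inner g2).cmul 2))
  · have pf := (f0.inner f1).cmul 2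
    have pg := (g0.inner g1).cmul 2
    exact ((((Dec.bmul b1 ((f1.inner f1).cmul 2)).add (Dec.bmul b2 ((g1.inner g1).cmul 2))).add
      (Dec.bmul b3 (Dec.bmul pf.bdd pf))).add ((Dec.bmul b4 (Dec.bmul pf.bdd pg)).cmul 2)).add
      (Dec.bmul b5 (Dec.bmul pg.bdd pg))

lemma btQ_lower (hε : 0 < ε) (p : ℝ) (hp : 1 < p) (hp2 : p ≤ 2)
    (hm : m = 1 / (p - 1)) (hθ : θ = 1 - p / 2)
    (hK : K = (2 + 16 * m ^ 2) / (p * (p - 1))) (s : ℝ) (x : R3) (k j : Fin 3) :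
    2 * (‖hfl (dd k f) s x‖ * ‖hfl (dd j g) s x‖) ≤ ∑ i, btQ K p θ m ε f g i s x := by
  set W := (sqe ε f s x + sqe ε g s x ^ m) ^ θ with hW
  have hA := sqe_pos hε f s x
  have hB := sqe_pos hε g s x
  have hW0 : 0 < W := by positivity
  have key : ∀ i, W⁻¹ * ‖hfl (dd i f) s x‖ ^ 2 + W * ‖hfl (dd i g) s x‖ ^ 2 ≤
      btQ K p θ m ε f g i s x := by
    intro i
    have cs : ∀ (u : R3 → V), (2 * inner ℝ (hfl u s x) (hfl (dd i u) s x)) ^ 2 ≤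
        4 * sqe ε u s x * ‖hfl (dd i u) s x‖ ^ 2 := by
      intro u
      have h1 := abs_real_inner_le_norm (hfl u s x) (hfl (dd i u) s x)
      have h2 : (inner ℝ (hfl u s x) (hfl (dd i u) s x)) ^ 2 ≤
          (‖hfl u s x‖ * ‖hfl (dd i u) s x‖) ^ 2 := by
        rw [← sq_abs]; gcongr
      unfold sqe
      have : 0 ≤ ε * ‖hfl (dd i u) s x‖ ^ 2 := by positivity
      nlinarith
    have := bellman_ineq p hp hp2 (sqe ε f s x) (sqe ε g s x) ‖hfl (dd i f) s x‖
      ‖hfl (dd i g) s x‖ (2 * inner ℝ (hfl f s x) (hfl (dd i f) s x))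
      (2 * inner ℝ (hfl g s x) (hfl (dd i g) s x)) hA hB (norm_nonneg _) (norm_nonneg _)
      (cs f) (cs g) K θ m hm hθ hK
    refine this.trans (le_of_eq ?_)
    unfold btQ
    rw [real_inner_self_eq_norm_sq, real_inner_self_eq_norm_sq]
    ring
  calc 2 * (‖hfl (dd k f) s x‖ * ‖hfl (dd j g) s x‖)
      ≤ W⁻¹ * ‖hfl (dd k f) s x‖ ^ 2 + W * ‖hfl (dd j g) s x‖ ^ 2 := by
        have e : W⁻¹ * ‖hfl (dd k f) s x‖ ^ 2 + W * ‖hfl (dd j g) s x‖ ^ 2 -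
          2 * (‖hfl (dd k f) s x‖ * ‖hfl (dd j g) s x‖) =
          W⁻¹ * (‖hfl (dd k f) s x‖ - W * ‖hfl (dd j g) s x‖) ^ 2 := by
            field_simp; ring
        have : 0 ≤ W⁻¹ * (‖hfl (dd k f) s x‖ - W * ‖hfl (dd j g) s x‖) ^ 2 := by positivity
        linarith
    _ ≤ ∑ i, W⁻¹ * ‖hfl (dd i f) s x‖ ^ 2 + ∑ i, W * ‖hfl (dd i g) s x‖ ^ 2 := by
        refine add_le_add ?_ ?_
        · exact Finset.single_le_sum (f := fun i => W⁻¹ * ‖hfl (dd i f) s x‖ ^ 2)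
            (fun i _ => by positivity) (Finset.mem_univ k)
        · exact Finset.single_le_sum (f := fun i => W * ‖hfl (dd i g) s x‖ ^ 2)
            (fun i _ => by positivity) (Finset.mem_univ j)
    _ ≤ _ := by
        rw [← Finset.sum_add_distrib]
        exact Finset.sum_le_sum fun i _ => key i

lemma bilinear_eps (hε : 0 < ε) (hf : Tst f) (hg : Tst g) (p : ℝ) (hp : 1 < p) (hp2 : p ≤ 2)
    (hm : m = 1 / (p - 1)) (hθ : θ = 1 - p / 2)
    (hK : K = (2 + 16 * m ^ 2) / (p * (p - 1))) (k j : Fin 3) {S : ℝ} (hS : 0 ≤ S) :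
    2 * (∫ s in (0 : ℝ)..S, s * ∫ x, ‖hfl (dd k f) s x‖ * ‖hfl (dd j g) s x‖) ≤
      ∫ x, (bF K p θ m (‖f x‖ ^ 2 + ε) (‖g x‖ ^ 2 + ε) - bF K p θ m ε ε) := by
  have hp1 : 0 < p - 1 := by linarith
  have hm0 : 0 ≤ m := by rw [hm]; positivity
  have hθ0 : 0 ≤ θ := by rw [hθ]; linarith
  have hK0 : 0 ≤ K := by rw [hK]; positivity
  have d := fun i => bt_dec (K := K) (p := p) (θ := θ) (m := m) hε hf hg hS i
  have dL : Dec S (fun s x => ∑ i, btL K p θ m ε f g i s x) := Dec.sum _ fun i => (d i).2.1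
  have dQ : Dec S (fun s x => ∑ i, btQ K p θ m ε f g i s x) := Dec.sum _ fun i => (d i).2.2
  have dN : Dec S (fun s x => ‖hfl (dd k f) s x‖ * ‖hfl (dd j g) s x‖) :=
    Dec.bmul (hfl_dec (hf.dd k) hS).norm.bdd (hfl_dec (hg.dd j) hS).norm
  obtain ⟨fi, fe⟩ := flux hS dL (fun s x => bt_ds hε hf hg s x)
  have z : ∀ s, 0 ≤ s → s ≤ S → ∫ x, ∑ i, btL K p θ m ε f g i s x =
      - ∫ x, ∑ i, btQ K p θ m ε f g i s x := by
    intro s h0 h1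
    have zi : ∀ i, ∫ x, btL K p θ m ε f g i s x = - ∫ x, btQ K p θ m ε f g i s x := by
      intro i
      have iL := (d i).2.1.integrable s h0 h1
      have iQ := (d i).2.2.integrable s h0 h1
      have := integral_line_zero (eb i) (fun x => bt1_dx hε hf hg i s x)
        ((d i).1.integrable s h0 h1) (iL.add iQ)
      rw [integral_add iL iQ] at this
      linarith
    rw [integral_finsetSum _ fun i _ => (d i).2.1.integrable s h0 h1,
      integral_finsetSum _ fun i _ => (d i).2.2.integrable s h0 h1, ← Finset.sum_neg_distrib]
    exact Finset.sum_congr rfl fun i _ => zi i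
  have e1 : ∫ s in (0 : ℝ)..S, s * ∫ x, ∑ i, btL K p θ m ε f g i s x =
      - ∫ s in (0 : ℝ)..S, s * ∫ x, ∑ i, btQ K p θ m ε f g i s x := by
    rw [← intervalIntegral.integral_neg]
    refine intervalIntegral.integral_congr fun s hs => ?_
    rw [Set.uIcc_of_le hS] at hs
    simp only [z s hs.1 hs.2, mul_neg]
  have e2 : 2 * (∫ s in (0 : ℝ)..S, s * ∫ x, ‖hfl (dd k f) s x‖ * ‖hfl (dd j g) s x‖) ≤
      ∫ s in (0 : ℝ)..S, s * ∫ x, ∑ i, btQ K p θ m ε f g i s x := by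
    rw [← intervalIntegral.integral_const_mul]
    refine intervalIntegral.integral_mono_on hS ((dN.intervalIntegrable hS).const_mul 2)
      (dQ.intervalIntegrable hS) fun s hs => ?_
    rw [← mul_assoc, mul_comm 2 s, mul_assoc, ← integral_const_mul]
    refine mul_le_mul_of_nonneg_left ?_ hs.1
    exact integral_mono ((dN.integrable s hs.1 hs.2).const_mul 2) (dQ.integrable s hs.1 hs.2)
      fun x => btQ_lower hε p hp hp2 hm hθ hK s x k j
  have e3 : ∀ x, bt K p θ m ε f g 0 x = bF K p θ m (‖f x‖ ^ 2 + ε) (‖g x‖ ^ 2 + ε) := by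
    intro x; simp [bt, sqe, hfl_zero]
  have i0 : Integrable (fun x =>
      (bF K p θ m (‖f x‖ ^ 2 + ε) (‖g x‖ ^ 2 + ε) - bF K p θ m ε ε)) := by
    refine Continuous.integrable_of_hasCompactSupport ?_ ?_
    · refine Continuous.sub ?_ continuous_const
      exact (bF_cont ((hf.cont.norm.pow 2).add continuous_const)
        ((hg.cont.norm.pow 2).add continuous_const) (fun x => add_pos_of_nonneg_of_pos (sq_nonneg _) hε)
        (fun x => add_pos_of_nonneg_of_pos (sq_nonneg _) hε)).1
    · refine HasCompactSupport.intro (hf.2.union hg.2) fun x hx => ?_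
      rw [Set.mem_union, not_or] at hx
      simp [image_eq_zero_of_notMem_tsupport hx.1, image_eq_zero_of_notMem_tsupport hx.2]
  have e4 : - ∫ x, (bF K p θ m (‖f x‖ ^ 2 + ε) (‖g x‖ ^ 2 + ε) - bF K p θ m ε ε) ≤
      ∫ x, (bt K p θ m ε f g S x - bt K p θ m ε f g 0 x) := by
    rw [← integral_neg]
    refine integral_mono i0.neg fi fun x => ?_
    simp only [e3]
    have : bF K p θ m ε ε ≤ bt K p θ m ε f g S x := by
      refine bF_mono hK0 (by linarith) hθ0 hm0 hε hε ?_ ?_ <;>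
      · unfold sqe; simp
    linarith
  rw [fe, e1] at e4
  linarith

end bil

end Flow

section Duality

variable {V : Type*} [NormedAddCommGroup V] [InnerProductSpace ℝ V] [FiniteDimensional ℝ V]

lemma dd_comm {u : R3 → V} (hu : Tst u) (j k : Fin 3) : dd j (dd k u) = dd k (dd j u) := by
  have h1 : ∀ x, DifferentiableAt ℝ (fderiv ℝ u) x := fun x =>
    ((hu.1.fderiv_right (m := (⊤ : ℕ∞)) (by simp)).differentiable (by simp)) x
  have h2 : ∀ (i l : Fin 3) x, dd i (dd l u) x = fderiv ℝ (fderiv ℝ u) x (eb i) (eb l) := by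
    intro i l x
    have e : dd l u = fun x => fderiv ℝ u x (eb l) := rfl
    rw [e]
    unfold dd
    rw [fderiv_clm_apply (h1 x) (differentiableAt_const _)]
    simp
  funext x
  rw [h2, h2]
  have := (hu.1.contDiffAt (x := x)).isSymmSndFDerivAt (n := (⊤ : ℕ∞))
    (by rw [minSmoothness_of_isRCLikeNormedField]; exact WithTop.coe_le_coe.2 le_top)
  exact this _ _

lemma Tst.clm {f : R3 → V} (hf : Tst f) (A : V →L[ℝ] V) : Tst (fun x => A (f x)) :=
  ⟨A.contDiff.comp hf.1, hf.2.comp_left (map_zero A)⟩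

lemma Tst.sum {ι : Type*} (I : Finset ι) {F : ι → R3 → V} (hF : ∀ i, Tst (F i)) :
    Tst (fun x => ∑ i ∈ I, F i x) := by
  refine ⟨ContDiff.sum fun i _ => (hF i).1, ?_⟩
  classical
  induction I using Finset.induction_on with
  | empty => exact HasCompactSupport.intro isCompact_empty (by simp)
  | insert i I hi ih =>
    simp only [Finset.sum_insert hi]
    exact (hF i).2.add ih

/-- Dirac-type first order operator -/
def dir (A : Fin 3 → V →L[ℝ] V) (u : R3 → V) (x : R3) : V := ∑ l, A l (dd l u x)

lemma dir_tst (A : Fin 3 → V →L[ℝ] V) {u : R3 → V} (hu : Tst u) : Tst (dir A u) :=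
  Tst.sum _ fun l => (hu.dd l).clm (A l)

lemma dd_dir (A : Fin 3 → V →L[ℝ] V) {u : R3 → V} (hu : Tst u) (k : Fin 3) (x : R3) :
    dd k (dir A u) x = ∑ l, A l (dd k (dd l u) x) := by
  have h : HasFDerivAt (dir A u) (∑ l, (A l).comp (fderiv ℝ (dd l u) x)) x :=
    HasFDerivAt.fun_sum fun l _ => (A l).hasFDerivAt.comp x ((hu.dd l).hasFDerivAt x)
  unfold dd
  rw [h.fderiv]
  simp
  rfl

lemma lap_dir (A : Fin 3 → V →L[ℝ] V)
    (hA : ∀ j k v, A j (A k v) + A k (A j v) = if j = k then (2 : ℝ) • v else 0)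
    {u : R3 → V} (hu : Tst u) (x : R3) :
    ∑ k, dd k (dd k u) x = ∑ k, A k (dd k (dir A u) x) := by
  simp_rw [dd_dir A hu, map_sum]
  have hsq : ∀ k v, A k (A k v) = v := by
    intro k v
    have := hA k k v
    rw [if_pos rfl, ← two_smul ℝ] at this
    exact smul_right_injective V (two_ne_zero) this
  have hz : ∀ j k v, j ≠ k → A j (A k v) = - A k (A j v) := by
    intro j k v h
    have := hA j k v
    rw [if_neg h] at this
    exact eq_neg_of_add_eq_zero_left this
  simp only [Fin.sum_univ_three, hsq]
  rw [dd_comm hu 1 0, dd_comm hu 2 0, dd_comm hu 2 1, hz 1 0 _ (by decide), hz 2 0 _ (by decide),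
    hz 2 1 _ (by decide)]
  abel

lemma hfl_lap (A : Fin 3 → V →L[ℝ] V)
    (hA : ∀ j k v, A j (A k v) + A k (A j v) = if j = k then (2 : ℝ) • v else 0)
    {u : R3 → V} (hu : Tst u) (s : ℝ) (x : R3) :
    ∑ k, hfl (dd k (dd k u)) s x = ∑ k, A k (hfl (dd k (dir A u)) s x) := by
  rw [← hfl_sum _ _ (fun k _ => (hu.dd k).dd k)]
  simp_rw [← hfl_clm (A _) ((dir_tst A hu).dd _)]
  rw [← hfl_sum Finset.univ (fun k z => A k (dd k (dir A u) z))
    (fun k _ => ((dir_tst A hu).dd k).clm (A k))]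
  congr 1
  funext z
  exact lap_dir A hA hu z

lemma flow_id {u g : R3 → V} (hu : Tst u) (hg : Tst g) (j : Fin 3) {s : ℝ} (hs : 0 ≤ s) :
    ∫ x, (inner ℝ (∑ k, hfl (dd k (dd k (dd j u))) s x) (hfl g s x) +
      inner ℝ (hfl (dd j u) s x) (∑ k, hfl (dd k (dd k g)) s x)) =
    - (2 * ∫ x, inner ℝ (∑ k, hfl (dd k (dd k u)) s x) (hfl (dd j g) s x)) := by
  have hj := hu.dd j
  have a1 : ∀ k, ∫ x, inner ℝ (hfl (dd k (dd k (dd j u))) s x) (hfl g s x) =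
      - ∫ x, inner ℝ (hfl (dd k (dd k u)) s x) (hfl (dd j g) s x) := by
    intro k
    rw [dd_comm hu k j, dd_comm (hu.dd k) k j]
    exact hfl_ibp ((hu.dd k).dd k) hg j hs
  have a2 : ∀ k, ∫ x, inner ℝ (hfl (dd j u) s x) (hfl (dd k (dd k g)) s x) =
      - ∫ x, inner ℝ (hfl (dd k (dd k u)) s x) (hfl (dd j g) s x) := by
    intro k
    rw [← a1 k, hfl_ibp (hj.dd k) hg k hs, hfl_ibp hj (hg.dd k) k hs, neg_neg]
  have i1 : ∀ k, Integrable fun x => inner ℝ (hfl (dd k (dd k (dd j u))) s x) (hfl g s x) :=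
    fun k => ((hfl_dec ((hj.dd k).dd k) hs).inner (hfl_dec hg hs)).integrable s hs le_rfl
  have i2 : ∀ k, Integrable fun x => inner ℝ (hfl (dd j u) s x) (hfl (dd k (dd k g)) s x) :=
    fun k => ((hfl_dec hj hs).inner (hfl_dec ((hg.dd k).dd k) hs)).integrable s hs le_rfl
  have i3 : ∀ k, Integrable fun x => inner ℝ (hfl (dd k (dd k u)) s x) (hfl (dd j g) s x) :=
    fun k => ((hfl_dec ((hu.dd k).dd k) hs).inner (hfl_dec (hg.dd j) hs)).integrable s hs le_rfl
  simp_rw [sum_inner, inner_sum]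
  rw [integral_add (integrable_finsetSum _ fun k _ => i1 k) (integrable_finsetSum _ fun k _ => i2 k),
    integral_finsetSum _ fun k _ => i1 k, integral_finsetSum _ fun k _ => i2 k,
    integral_finsetSum _ fun k _ => i3 k]
  simp_rw [a1, a2, Finset.sum_neg_distrib]
  ring

lemma flow_bound (A : Fin 3 → V →L[ℝ] V)
    (hA : ∀ j k v, A j (A k v) + A k (A j v) = if j = k then (2 : ℝ) • v else 0)
    {M : ℝ} (hM : ∀ k, ‖A k‖ ≤ M)
    {u g : R3 → V} (hu : Tst u) (hg : Tst g) (j : Fin 3) {B : ℝ} {S : ℝ} (hS : 0 ≤ S)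
    (hB : ∀ k, 2 * (∫ s in (0 : ℝ)..S, s * ∫ x, ‖hfl (dd k (dir A u)) s x‖ *
      ‖hfl (dd j g) s x‖) ≤ B) :
    |(∫ x, inner ℝ (hfl (dd j u) S x) (hfl g S x)) - ∫ x, inner ℝ (dd j u x) (g x)| ≤
      3 * M * B := by
  have hM0 : 0 ≤ M := (norm_nonneg _).trans (hM 0)
  have hj := hu.dd j
  have hf := dir_tst A hu
  set L : ℝ → R3 → ℝ := fun s x => inner ℝ (∑ k, hfl (dd k (dd k (dd j u))) s x) (hfl g s x) +
      inner ℝ (hfl (dd j u) s x) (∑ k, hfl (dd k (dd k g)) s x) with hL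
  have dL : Dec S L := by
    simp only [hL, sum_inner, inner_sum]
    exact (Dec.sum _ fun k => (hfl_dec ((hj.dd k).dd k) hS).inner (hfl_dec hg hS)).add
      (Dec.sum _ fun k => (hfl_dec hj hS).inner (hfl_dec ((hg.dd k).dd k) hS))
  have dN : ∀ k, Dec S (fun s x => ‖hfl (dd k (dir A u)) s x‖ * ‖hfl (dd j g) s x‖) := fun k =>
    Dec.bmul (hfl_dec (hf.dd k) hS).norm.bdd (hfl_dec (hg.dd j) hS).norm
  obtain ⟨-, fe⟩ := flux hS (F := fun s x => inner ℝ (hfl (dd j u) s x) (hfl g s x)) dL (by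
    intro s x
    refine ((hfl_ds hj s x).inner ℝ (hfl_ds hg s x)).congr_deriv ?_
    simp only [hL, real_inner_smul_left, real_inner_smul_right]
    ring)
  simp only [hfl_zero] at fe
  have iS := ((hfl_dec hj hS).inner (hfl_dec hg hS)).integrable S hS le_rfl
  have i0 := ((hfl_dec hj hS).inner (hfl_dec hg hS)).integrable 0 le_rfl hS
  simp only [hfl_zero] at i0
  rw [integral_sub iS i0] at fe
  rw [fe]
  have bd : ∀ s, 0 ≤ s → s ≤ S → |∫ x, L s x| ≤
      ∑ k, 2 * M * ∫ x, ‖hfl (dd k (dir A u)) s x‖ * ‖hfl (dd j g) s x‖ := by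
    intro s h0 h1
    rw [hL, flow_id hu hg j h0, abs_neg, abs_mul, abs_two]
    simp_rw [mul_assoc, ← Finset.mul_sum]
    refine mul_le_mul_of_nonneg_left ?_ (by norm_num)
    rw [← integral_finsetSum _ fun k _ => (dN k).integrable s h0 h1, ← integral_const_mul,
      ← Real.norm_eq_abs]
    refine norm_integral_le_of_norm_le ((integrable_finsetSum _ fun k _ =>
      (dN k).integrable s h0 h1).const_mul M) (Filter.Eventually.of_forall fun x => ?_)
    rw [hfl_lap A hA hu]
    refine (norm_inner_le_norm _ _).trans ?_
    rw [← Finset.sum_mul, ← mul_assoc, Finset.mul_sum]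
    refine mul_le_mul_of_nonneg_right ((norm_sum_le _ _).trans ?_) (norm_nonneg _)
    exact Finset.sum_le_sum fun k _ => (A k).le_of_opNorm_le (hM k) _
  have key : |∫ s in (0 : ℝ)..S, s * ∫ x, L s x| ≤ ∫ s in (0 : ℝ)..S,
      ∑ k, M * (2 * (s * ∫ x, ‖hfl (dd k (dir A u)) s x‖ * ‖hfl (dd j g) s x‖)) := by
    rw [← Real.norm_eq_abs]
    refine intervalIntegral.norm_integral_le_of_norm_le hS
      (Filter.Eventually.of_forall fun s hs => ?_) ?_
    · rw [norm_mul, Real.norm_of_nonneg hs.1.le, Real.norm_eq_abs]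
      refine (mul_le_mul_of_nonneg_left (bd s hs.1.le hs.2) hs.1.le).trans (le_of_eq ?_)
      rw [Finset.mul_sum]
      exact Finset.sum_congr rfl fun k _ => by ring
    · have k := fun k : Fin 3 => (((dN k).intervalIntegrable hS).const_mul 2).const_mul M
      simp only [Fin.sum_univ_three]
      exact ((k 0).add (k 1)).add (k 2)
  refine key.trans ?_
  rw [intervalIntegral.integral_finsetSum
    (fun k _ => (((dN k).intervalIntegrable hS).const_mul 2).const_mul M)]
  simp_rw [intervalIntegral.integral_const_mul]
  refine (Finset.sum_le_sum fun k _ => mul_le_mul_of_nonneg_left (hB k) hM0).trans (le_of_eq ?_)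
  simp
  ring

lemma duality (A : Fin 3 → V →L[ℝ] V)
    (hA : ∀ j k v, A j (A k v) + A k (A j v) = if j = k then (2 : ℝ) • v else 0)
    {M : ℝ} (hM : ∀ k, ‖A k‖ ≤ M)
    {u g : R3 → V} (hu : Tst u) (hg : Tst g) (j : Fin 3) {B : ℝ}
    (hB : ∀ k S, 0 ≤ S → 2 * (∫ s in (0 : ℝ)..S, s * ∫ x, ‖hfl (dd k (dir A u)) s x‖ *
      ‖hfl (dd j g) s x‖) ≤ B) :
    |∫ x, inner ℝ (dd j u x) (g x)| ≤ 3 * M * B := by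
  have hj := hu.dd j
  have hgz := gz_pos
  set c := gz⁻¹ * (∫ y, ‖g y‖) * ∫ y, ‖dd j u y‖ with hc
  have h1 : ∀ S : ℝ, 0 < S → |∫ x, inner ℝ (dd j u x) (g x)| ≤ c * (S ^ 3)⁻¹ + 3 * M * B := by
    intro S hS
    have b1 := flow_bound A hA hM hu hg j hS.le (fun k => hB k S hS.le)
    have b2 : |∫ x, inner ℝ (hfl (dd j u) S x) (hfl g S x)| ≤ c * (S ^ 3)⁻¹ := by
      have iS := (hfl_dec hj hS.le).norm.integrable S hS.le le_rfl
      have h0 : 0 ≤ ∫ y, ‖g y‖ := integral_nonneg fun y => norm_nonneg _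
      calc _ ≤ ∫ x, ‖hfl (dd j u) S x‖ * (gz⁻¹ * (S ^ 3)⁻¹ * ∫ y, ‖g y‖) := by
            rw [← Real.norm_eq_abs]
            refine norm_integral_le_of_norm_le (iS.mul_const _)
              (Filter.Eventually.of_forall fun x => (norm_inner_le_norm _ _).trans ?_)
            exact mul_le_mul_of_nonneg_left (hfl_sup hg S hS x) (norm_nonneg _)
        _ = (∫ x, ‖hfl (dd j u) S x‖) * (gz⁻¹ * (S ^ 3)⁻¹ * ∫ y, ‖g y‖) := integral_mul_const _ _
        _ ≤ (∫ y, ‖dd j u y‖) * (gz⁻¹ * (S ^ 3)⁻¹ * ∫ y, ‖g y‖) := by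
            refine mul_le_mul_of_nonneg_right (hfl_l1 hj S) (by positivity)
        _ = _ := by rw [hc]; ring
    have := abs_sub_abs_le_abs_sub (∫ x, inner ℝ (dd j u x) (g x))
      (∫ x, inner ℝ (hfl (dd j u) S x) (hfl g S x))
    rw [abs_sub_comm] at this
    linarith
  have t : Filter.Tendsto (fun S : ℝ => c * (S ^ 3)⁻¹ + 3 * M * B) Filter.atTop
      (nhds (c * 0 + 3 * M * B)) :=
    ((tendsto_inv_atTop_zero.comp (Filter.tendsto_pow_atTop (by norm_num))).const_mul c).add_const _
  rw [mul_zero, zero_add] at t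
  exact ge_of_tendsto t ((Filter.eventually_gt_atTop 0).mono h1)

end Duality

section Lp

variable {V : Type*} [NormedAddCommGroup V] [InnerProductSpace ℝ V] [FiniteDimensional ℝ V]

lemma sq_rpow_half (v : V) (p : ℝ) : (‖v‖ ^ 2) ^ (p / 2) = ‖v‖ ^ p := by
  rw [← Real.rpow_natCast, ← Real.rpow_mul (norm_nonneg _)]
  congr 1
  push_cast; ring

lemma tst_pow_int {f : R3 → V} (hf : Tst f) {p : ℝ} (hp : 0 < p) :
    Integrable (fun x => ‖f x‖ ^ p) := by
  refine (hf.cont.norm.rpow_const fun x => Or.inr hp.le).integrable_of_hasCompactSupport ?_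
  refine HasCompactSupport.intro hf.2 fun x hx => ?_
  simp [image_eq_zero_of_notMem_tsupport hx, Real.zero_rpow hp.ne']

lemma setint_pow {f : R3 → V} {p : ℝ} (hp : 0 < p) {T : Set R3} (hT : tsupport f ⊆ T) :
    ∫ x in T, (‖f x‖ ^ 2 + 0) ^ (p / 2) = ∫ x, ‖f x‖ ^ p := by
  simp_rw [add_zero, sq_rpow_half]
  refine setIntegral_eq_integral_of_forall_compl_eq_zero fun x hx => ?_
  have : x ∉ tsupport f := fun h => hx (hT h)
  simp [image_eq_zero_of_notMem_tsupport this, Real.zero_rpow hp.ne']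

lemma eps_cont {f : R3 → V} (hf : Tst f) {p : ℝ} (hp : 0 < p) {T : Set R3} (hT : IsCompact T) :
    Continuous (fun ε : ℝ => ∫ x in T, (‖f x‖ ^ 2 + ε) ^ (p / 2)) := by
  refine continuous_parametric_integral_of_continuous ?_ hT
  have := hf.cont
  refine Continuous.rpow_const ?_ fun x => Or.inr (by positivity)
  fun_prop

lemma eps_int {f : R3 → V} (hf : Tst f) {p : ℝ} (hp : 0 < p) {T : Set R3} (hT : IsCompact T)
    (ε : ℝ) : IntegrableOn (fun x => (‖f x‖ ^ 2 + ε) ^ (p / 2)) T := by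
  have := hf.cont
  refine (Continuous.continuousOn ?_).integrableOn_compact hT
  refine Continuous.rpow_const ?_ fun x => Or.inr (by positivity)
  fun_prop

lemma eps_limit {f g : R3 → V} (hf : Tst f) (hg : Tst g) {K θ m p q X : ℝ}
    (hp : 1 < p) (hp2 : p ≤ 2)
    (hm : m = 1 / (p - 1)) (hθ : θ = 1 - p / 2) (hq : q = p / (p - 1)) (hK : 0 ≤ K)
    (hX : ∀ ε > 0, X ≤ ∫ x, (bF K p θ m (‖f x‖ ^ 2 + ε) (‖g x‖ ^ 2 + ε) - bF K p θ m ε ε)) :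
    X ≤ (K + 1) * (∫ x, ‖f x‖ ^ p) + ∫ x, ‖g x‖ ^ q := by
  have hp1 : 0 < p - 1 := by linarith
  have hp0 : 0 < p := by linarith
  have hq0 : 0 < q := by rw [hq]; positivity
  set T := tsupport f ∪ tsupport g with hT
  have hTc : IsCompact T := hf.2.isCompact.union hg.2.isCompact
  have c : Continuous (fun ε : ℝ => (K + 1) * (∫ x in T, (‖f x‖ ^ 2 + ε) ^ (p / 2)) +
      ∫ x in T, (‖g x‖ ^ 2 + ε) ^ (q / 2)) :=
    ((eps_cont hf hp0 hTc).const_mul _).add (eps_cont hg hq0 hTc)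
  have t := (c.tendsto 0).mono_left (nhdsWithin_le_nhds (s := Set.Ioi 0))
  rw [setint_pow hp0 Set.subset_union_left, setint_pow hq0 Set.subset_union_right] at t
  refine ge_of_tendsto t (Filter.eventually_of_mem self_mem_nhdsWithin fun ε (hε : 0 < ε) => ?_)
  refine (hX ε hε).trans ?_
  have e : ∫ x, (bF K p θ m (‖f x‖ ^ 2 + ε) (‖g x‖ ^ 2 + ε) - bF K p θ m ε ε) =
      ∫ x in T, (bF K p θ m (‖f x‖ ^ 2 + ε) (‖g x‖ ^ 2 + ε) - bF K p θ m ε ε) := by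
    refine (setIntegral_eq_integral_of_forall_compl_eq_zero fun x hx => ?_).symm
    rw [hT, Set.mem_union, not_or] at hx
    simp [image_eq_zero_of_notMem_tsupport hx.1, image_eq_zero_of_notMem_tsupport hx.2]
  have i1 := (eps_int hf hp0 hTc ε).const_mul (K + 1)
  have i2 := eps_int hg hq0 hTc ε
  rw [e, ← integral_const_mul, ← integral_add i1 i2]
  have hpos : ∀ v : V, 0 < ‖v‖ ^ 2 + ε := fun v => add_pos_of_nonneg_of_pos (sq_nonneg _) hε
  have hc : Continuous (fun x => bF K p θ m (‖f x‖ ^ 2 + ε) (‖g x‖ ^ 2 + ε)) :=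
    (bF_cont ((hf.cont.norm.pow 2).add continuous_const)
        ((hg.cont.norm.pow 2).add continuous_const) (fun x => hpos _) (fun x => hpos _)).1
  refine integral_mono ((hc.sub continuous_const).continuousOn.integrableOn_compact hTc)
    (i1.add i2) fun x => ?_
  have b1 := bF_upper p hp hp2 (‖f x‖ ^ 2 + ε) (‖g x‖ ^ 2 + ε) (hpos _) (hpos _) K θ m q hm hθ hq
  have b2 := bF_nonneg (p := p) (θ := θ) (m := m) hK hε hε
  simp only [Pi.add_apply]
  linarith

lemma bilin (p q : ℝ) (hp : 1 < p) (hq : q = p / (p - 1)) :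
    ∃ C : ℝ, 0 < C ∧ ∀ f g : R3 → V, Tst f → Tst g → ∀ k j S, 0 ≤ S →
      2 * (∫ s in (0 : ℝ)..S, s * ∫ x, ‖hfl (dd k f) s x‖ * ‖hfl (dd j g) s x‖) ≤
      C * ((∫ x, ‖f x‖ ^ p) + ∫ x, ‖g x‖ ^ q) := by
  have hp1 : 0 < p - 1 := by linarith
  by_cases hp2 : p ≤ 2
  · have hK : 0 ≤ (2 + 16 * (1 / (p - 1)) ^ 2) / (p * (p - 1)) := by positivity
    refine ⟨_ + 1, add_pos_of_nonneg_of_pos hK one_pos, fun f g hf hg k j S hS => ?_⟩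
    have := eps_limit hf hg hp hp2 rfl rfl hq hK
      (fun ε hε => bilinear_eps hε hf hg p hp hp2 rfl rfl rfl k j hS)
    have h0 : 0 ≤ ∫ x, ‖g x‖ ^ q := integral_nonneg fun x => by positivity
    refine this.trans ?_
    nlinarith
  · push Not at hp2
    have hq1 : 1 < q := by rw [hq, lt_div_iff₀ hp1]; linarith
    have hq2 : q ≤ 2 := by rw [hq, div_le_iff₀ hp1]; linarith
    have hqm : q - 1 = 1 / (p - 1) := by rw [hq]; field_simp; ring
    have hpq : p = q / (q - 1) := by rw [hqm, hq]; field_simp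
    have hq1' : 0 < q - 1 := by linarith
    have hK : 0 ≤ (2 + 16 * (1 / (q - 1)) ^ 2) / (q * (q - 1)) := by positivity
    refine ⟨_ + 1, add_pos_of_nonneg_of_pos hK one_pos, fun f g hf hg k j S hS => ?_⟩
    have := eps_limit hg hf hq1 hq2 rfl rfl hpq hK
      (fun ε hε => bilinear_eps hε hg hf q hq1 hq2 rfl rfl rfl j k hS)
    have h0 : 0 ≤ ∫ x, ‖f x‖ ^ p := integral_nonneg fun x => by positivity
    simp_rw [mul_comm ‖hfl (dd k f) _ _‖]
    refine this.trans ?_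
    nlinarith

lemma dual_bound (A : Fin 3 → V →L[ℝ] V)
    (hA : ∀ j k v, A j (A k v) + A k (A j v) = if j = k then (2 : ℝ) • v else 0)
    (p q : ℝ) (hp : 1 < p) (hq : q = p / (p - 1)) :
    ∃ C : ℝ, 0 < C ∧ ∀ u g : R3 → V, Tst u → Tst g → ∀ j,
      |∫ x, inner ℝ (dd j u x) (g x)| ≤
        C * ((∫ x, ‖dir A u x‖ ^ p) + ∫ x, ‖g x‖ ^ q) := by
  obtain ⟨C, hC, h⟩ := bilin (V := V) p q hp hq
  have hM : ∀ k, ‖A k‖ ≤ 1 + ∑ i, ‖A i‖ := fun k => by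
    have := Finset.single_le_sum (f := fun i => ‖A i‖) (fun i _ => norm_nonneg _)
      (Finset.mem_univ k)
    linarith
  have h0 : 0 ≤ ∑ i, ‖A i‖ := Finset.sum_nonneg fun i _ => norm_nonneg _
  refine ⟨3 * (1 + ∑ i, ‖A i‖) * C, by positivity, fun u g hu hg j => ?_⟩
  rw [mul_assoc (3 * (1 + ∑ i, ‖A i‖))]
  exact duality A hA hM hu hg j (fun k S hS => h _ g (dir_tst A hu) hg k j S hS)

lemma eps_alg {ε y a : ℝ} (hε : 0 < ε) (hy : ε ≤ y) (ha : 0 < a) :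
    ε * y ^ (a - 1) ≤ y ^ a / 2 + (2 * ε) ^ a := by
  have hy0 : 0 < y := hε.trans_le hy
  have e : y ^ a = y * y ^ (a - 1) := by
    rw [← Real.rpow_one_add' hy0.le (by linarith)]; congr 1; ring
  have h1 : 0 < y ^ (a - 1) := by positivity
  have h2 : 0 < (2 * ε) ^ a := by positivity
  by_cases h : 2 * ε ≤ y
  · rw [e]; nlinarith
  · push Not at h
    have h3 : y ^ a ≤ (2 * ε) ^ a := Real.rpow_le_rpow hy0.le h.le ha.le
    have h4 : ε * y ^ (a - 1) ≤ y * y ^ (a - 1) := by gcongr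
    have : 0 < y ^ a := by positivity
    linarith

lemma dirac_lp (A : Fin 3 → V →L[ℝ] V)
    (hA : ∀ j k v, A j (A k v) + A k (A j v) = if j = k then (2 : ℝ) • v else 0)
    (p : ℝ) (hp : 1 < p) :
    ∃ C : ℝ, 0 < C ∧ ∀ u : R3 → V, Tst u → ∀ j,
      ∫ x, ‖dd j u x‖ ^ p ≤ C * ∫ x, ‖dir A u x‖ ^ p := by
  have hp1 : 0 < p - 1 := by linarith
  have hp0 : 0 < p := by linarith
  obtain ⟨C, hC, hdb⟩ := dual_bound A hA p (p / (p - 1)) hp rfl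
  set q := p / (p - 1) with hq
  have hq0 : 0 < q := by positivity
  set μ := (1 / (4 * C)) ^ (p - 1) with hμ
  have hμ0 : 0 < μ := by positivity
  have hμq : C * μ ^ q = μ / 4 := by
    have e1 : μ ^ q = (1 / (4 * C)) ^ p := by
      rw [hμ, ← Real.rpow_mul (by positivity), hq]; congr 1; field_simp
    have e2 : (1 / (4 * C)) ^ p = (1 / (4 * C)) * μ := by
      rw [hμ, ← Real.rpow_one_add' (by positivity) (by linarith)]; congr 1; ring
    rw [e1, e2]; field_simp
  refine ⟨4 * C / μ, by positivity, fun u hu j => ?_⟩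
  set h := dd j u with hh
  have hj : Tst h := hu.dd j
  set T := tsupport h with hT
  have hTc : IsCompact T := hj.2.isCompact
  set F := ∫ x, ‖dir A u x‖ ^ p with hF
  have key : ∀ ε > 0, μ / 4 * (∫ x in T, (‖h x‖ ^ 2 + ε) ^ (p / 2)) ≤
      C * F + μ * ((2 * ε) ^ (p / 2) * volume.real T) := by
    intro ε hε
    have hpos : ∀ x, 0 < ‖h x‖ ^ 2 + ε := fun x => add_pos_of_nonneg_of_pos (sq_nonneg _) hε
    set g : R3 → V := fun x => (μ * (‖h x‖ ^ 2 + ε) ^ (p / 2 - 1)) • h x with hg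
    have hgT : Tst g := by
      refine ⟨?_, hj.2.smul_left⟩
      refine ContDiff.smul (contDiff_const.mul ?_) hj.1
      exact ContDiff.rpow_const_of_ne ((hj.1.norm_sq ℝ).add contDiff_const) fun x => (hpos x).ne'
    have hb := (le_abs_self _).trans (hdb u g hu hgT j)
    have g0 : ∀ x, x ∉ T → g x = 0 := fun x hx => by
      simp [hg, image_eq_zero_of_notMem_tsupport hx]
    have i0 := eps_int hj hp0 hTc ε
    have l1 : ∫ x, ‖g x‖ ^ q ≤ μ ^ q * ∫ x in T, (‖h x‖ ^ 2 + ε) ^ (p / 2) := by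
      rw [← setIntegral_eq_integral_of_forall_compl_eq_zero (s := T) (f := fun x => ‖g x‖ ^ q)
        (fun x hx => by rw [g0 x hx, norm_zero, Real.zero_rpow hq0.ne']), ← integral_const_mul]
      refine integral_mono (tst_pow_int hgT hq0).integrableOn (i0.const_mul _) fun x => ?_
      have hy := hpos x
      have n1 : ‖h x‖ ≤ (‖h x‖ ^ 2 + ε) ^ (1 / 2 : ℝ) := by
        rw [← Real.sqrt_eq_rpow]
        exact Real.le_sqrt_of_sq_le (by linarith)
      have n2 : ‖g x‖ ≤ μ * (‖h x‖ ^ 2 + ε) ^ ((p - 1) / 2) := by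
        have e : (‖h x‖ ^ 2 + ε) ^ ((p - 1) / 2) =
            (‖h x‖ ^ 2 + ε) ^ (p / 2 - 1) * (‖h x‖ ^ 2 + ε) ^ (1 / 2 : ℝ) := by
          rw [← Real.rpow_add hy]; congr 1; ring
        rw [hg, norm_smul, Real.norm_of_nonneg (by positivity), e, ← mul_assoc]
        gcongr
      calc ‖g x‖ ^ q ≤ (μ * (‖h x‖ ^ 2 + ε) ^ ((p - 1) / 2)) ^ q := by gcongr
        _ = μ ^ q * (‖h x‖ ^ 2 + ε) ^ (p / 2) := by
          rw [Real.mul_rpow hμ0.le (by positivity), ← Real.rpow_mul hy.le]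
          congr 2
          rw [hq]; field_simp
    have l2 : μ * ((∫ x in T, (‖h x‖ ^ 2 + ε) ^ (p / 2)) / 2 -
        (2 * ε) ^ (p / 2) * volume.real T) ≤ ∫ x, inner ℝ (h x) (g x) := by
      rw [← setIntegral_eq_integral_of_forall_compl_eq_zero (s := T)
        (f := fun x => inner ℝ (h x) (g x)) (fun x hx => by rw [g0 x hx, inner_zero_right])]
      have ec : (2 * ε) ^ (p / 2) * volume.real T = ∫ x in T, (2 * ε) ^ (p / 2) := by
        rw [setIntegral_const, smul_eq_mul, mul_comm]
      have ic : IntegrableOn (fun _ : R3 => (2 * ε) ^ (p / 2)) T :=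
        continuousOn_const.integrableOn_compact hTc
      rw [ec, ← integral_div, ← integral_sub (i0.div_const 2) ic, ← integral_const_mul]
      refine integral_mono (((i0.div_const 2).sub ic).const_mul μ)
        ((hj.cont.inner hgT.cont).continuousOn.integrableOn_compact hTc) fun x => ?_
      have hy := hpos x
      have e1 : inner ℝ (h x) (g x) = μ * ((‖h x‖ ^ 2 + ε) ^ (p / 2) -
          ε * (‖h x‖ ^ 2 + ε) ^ (p / 2 - 1)) := by
        have e : (‖h x‖ ^ 2 + ε) ^ (p / 2) =
            (‖h x‖ ^ 2 + ε) * (‖h x‖ ^ 2 + ε) ^ (p / 2 - 1) := by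
          rw [← Real.rpow_one_add' hy.le (by linarith)]; congr 1; ring
        rw [hg, e]
        simp only [real_inner_smul_right, real_inner_self_eq_norm_sq]
        ring
      have := eps_alg hε (by nlinarith [sq_nonneg ‖h x‖] : ε ≤ ‖h x‖ ^ 2 + ε)
        (by positivity : 0 < p / 2)
      simp only [Pi.sub_apply]
      rw [e1]
      refine mul_le_mul_of_nonneg_left ?_ hμ0.le
      linarith
    have l3 := mul_le_mul_of_nonneg_left l1 hC.le
    rw [← mul_assoc, hμq] at l3
    rw [mul_add] at hb
    linarith
  have t1 := (((eps_cont hj hp0 hTc).const_mul (μ / 4)).tendsto 0).mono_left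
    (nhdsWithin_le_nhds (s := Set.Ioi 0))
  have c2 : Continuous fun ε : ℝ => C * F + μ * ((2 * ε) ^ (p / 2) * volume.real T) := by
    have : Continuous fun ε : ℝ => (2 * ε) ^ (p / 2) :=
      Continuous.rpow_const (by fun_prop) fun x => Or.inr (by positivity)
    fun_prop
  have t2 := (c2.tendsto 0).mono_left (nhdsWithin_le_nhds (s := Set.Ioi 0))
  have fin := le_of_tendsto_of_tendsto t1 t2
    (Filter.eventually_of_mem self_mem_nhdsWithin fun ε (hε : 0 < ε) => key ε hε)
  rw [setint_pow hp0 subset_rfl, mul_zero, Real.zero_rpow (by positivity), zero_mul, mul_zero,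
    add_zero] at fin
  rw [div_mul_eq_mul_div, le_div_iff₀ hμ0]
  linarith

end Lp

/-- the Pauli-Dirac matrices as real-linear operators -/
def pdA (j : Fin 3) : C4 →L[ℝ] C4 :=
  (Matrix.toEuclideanCLM (𝕜 := ℂ) (pauliDirac j)).restrictScalars ℝ

lemma pdA_apply (j : Fin 3) (v : C4) : pdA j v = mulC4 (pauliDirac j) v := by
  rfl

set_option maxHeartbeats 4000000 in
lemma pd_rel (j k : Fin 3) : pauliDirac j * pauliDirac k + pauliDirac k * pauliDirac j =
    if j = k then (2 : ℂ) • 1 else 0 := by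
  fin_cases j <;> fin_cases k <;> ext a b <;> fin_cases a <;> fin_cases b <;>
    simp [pauliDirac, Matrix.mul_apply, Fin.sum_univ_four, Matrix.one_apply] <;> norm_num

lemma pdA_rel (j k : Fin 3) (v : C4) :
    pdA j (pdA k v) + pdA k (pdA j v) = if j = k then (2 : ℝ) • v else 0 := by
  have h := congrArg (fun M => Matrix.toEuclideanCLM (𝕜 := ℂ) M v) (pd_rel j k)
  simp only [map_add, map_mul] at h
  refine Eq.trans (b := _) h ?_
  split_ifs
  · rw [map_smul, map_one]
    ext i
    simp
  · simp

/-- `‖∇u‖_{L^p} ≤ C ‖(−i α·∇)u‖_{L^p}` for `1<p<∞`. -/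
theorem stmt11 (p : ℝ) (hp : 1 < p) :
    ∃ C : ℝ, 0 < C ∧ ∀ u : R3 → C4, ContDiff ℝ (⊤ : ℕ∞) u → HasCompactSupport u →
      (∫ x : R3, (∑ j : Fin 3, ‖pderiv3 u j x‖ ^ 2) ^ (p / 2)) ^ (1 / p)
        ≤ C * (∫ x : R3, ‖(-Complex.I) • alphaGrad u x‖ ^ p) ^ (1 / p) := by
  have hp0 : 0 < p := by linarith
  obtain ⟨C, hC, h⟩ := dirac_lp pdA pdA_rel p hp
  set D := 3 ^ (p / 2) * (3 * C) with hD
  have hD0 : 0 < D := by positivity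
  refine ⟨D ^ (1 / p), by positivity, fun u h1 h2 => ?_⟩
  have hu : Tst u := ⟨h1, h2⟩
  have e : ∀ x, ‖(-Complex.I) • alphaGrad u x‖ = ‖dir pdA u x‖ := by
    intro x
    rw [norm_smul, norm_neg, Complex.norm_I, one_mul]
    rfl
  simp_rw [e]
  have hF : 0 ≤ ∫ x, ‖dir pdA u x‖ ^ p := integral_nonneg fun x => by positivity
  rw [← Real.mul_rpow hD0.le hF]
  have i1 : ∀ j, Integrable fun x => ‖dd j u x‖ ^ p := fun j => tst_pow_int (hu.dd j) hp0
  refine Real.rpow_le_rpow (integral_nonneg fun x => by positivity) ?_ (by positivity)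
  have pt : ∀ x, (∑ j : Fin 3, ‖pderiv3 u j x‖ ^ 2) ^ (p / 2) ≤
      3 ^ (p / 2) * ∑ j, ‖dd j u x‖ ^ p := by
    intro x
    obtain ⟨i, -, hi⟩ := Finset.exists_max_image (Finset.univ : Finset (Fin 3))
      (fun j => ‖dd j u x‖ ^ 2) Finset.univ_nonempty
    have b : ∑ j : Fin 3, ‖pderiv3 u j x‖ ^ 2 ≤ 3 * ‖dd i u x‖ ^ 2 := by
      refine (Finset.sum_le_card_nsmul _ _ _ hi).trans (le_of_eq ?_)
      simp
    calc _ ≤ (3 * ‖dd i u x‖ ^ 2) ^ (p / 2) := by gcongr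
      _ = 3 ^ (p / 2) * ‖dd i u x‖ ^ p := by
        rw [Real.mul_rpow (by norm_num) (by positivity), sq_rpow_half]
      _ ≤ _ := by
        refine mul_le_mul_of_nonneg_left ?_ (by positivity)
        exact Finset.single_le_sum (f := fun j => ‖dd j u x‖ ^ p) (fun j _ => by positivity)
          (Finset.mem_univ i)
  calc _ ≤ ∫ x, 3 ^ (p / 2) * ∑ j, ‖dd j u x‖ ^ p := by
        refine integral_mono_of_nonneg (Filter.Eventually.of_forall fun x => by positivity)
          ((integrable_finsetSum _ fun j _ => i1 j).const_mul _) (Filter.Eventually.of_forall pt)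
    _ = 3 ^ (p / 2) * ∑ j, ∫ x, ‖dd j u x‖ ^ p := by
        rw [integral_const_mul, integral_finsetSum _ fun j _ => i1 j]
    _ ≤ 3 ^ (p / 2) * ∑ _j : Fin 3, C * ∫ x, ‖dir pdA u x‖ ^ p := by
        gcongr with j
        exact h u hu j
    _ = _ := by
        rw [hD]; simp; ring
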